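/- arXiv:2601.04747 — 4 statements merged into one kernel-verified Lean document; each statement's English description precedes it below -/
import Mathlib

section
/- Let k ≥ 1 and let S be a finite semigroup such that S^k is a rectangular band, i.e. a·a = a for all a ∈ S^k and a·b·c = a·c for all a, b, c ∈ S^k. Then for every subset Σ ⊆ S and every t in the subsemigroup generated by Σ, there exists a straight-line program over Σ of width 2 and length at most 6k − 3 computing t. -/
/-- Product of a nonempty list of semigroup elements (head times the rest). -/
def listProd₁ {S : Type*} [Semigroup S] : S → List S → S
  | a, [] => a
  | a, b :: l => listProd₁ (a * b) l

/-- `Σ^{≤k}`: elements expressible as a nonempty product of at most `k` elements of `Sig`. -/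
def ProdLE {S : Type*} [Semigroup S] (Sig : Set S) (k : ℕ) : Set S :=
  { t | ∃ (a : S) (L : List S),
      a ∈ Sig ∧ (∀ x ∈ L, x ∈ Sig) ∧ L.length + 1 ≤ k ∧ listProd₁ a L = t }

/-- `S^k`: the set of all products of exactly `k` elements of `S`. -/
def powSet (S : Type*) [Semigroup S] (k : ℕ) : Set S :=
  { t | ∃ (a : S) (L : List S), L.length + 1 = k ∧ listProd₁ a L = t }

/-- An instruction of a straight-line program with `w` registers: either load a
generator into a register, or assign the product of two registers to a register. -/
inductive SLPInstr (S : Type*) (w : ℕ) where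
  | load (k : Fin w) (s : S) : SLPInstr S w
  | mul (k i j : Fin w) : SLPInstr S w

/-- Execute one instruction on the register state. -/
def SLPStep {S : Type*} [Semigroup S] {w : ℕ} (st : Fin w → Option S) :
    SLPInstr S w → (Fin w → Option S)
  | .load k s => Function.update st k (some s)
  | .mul k i j => Function.update st k (Option.map₂ (· * ·) (st i) (st j))

/-- The list of register states during the execution (all registers start empty). -/
def SLPStates {S : Type*} [Semigroup S] {w : ℕ} (P : List (SLPInstr S w)) :
    List (Fin w → Option S) :=
  List.scanl SLPStep (fun _ => none) P

/-- Validity of a straight-line program over `Sig`: loads use elements of `Sig`, and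
multiplications only use registers that have been assigned earlier. -/
def SLPValid {S : Type*} [Semigroup S] {w : ℕ} (Sig : Set S) (P : List (SLPInstr S w)) : Prop :=
  ∀ m : Fin P.length,
    match P.get m with
    | SLPInstr.load _ s => s ∈ Sig
    | SLPInstr.mul _ i j =>
        ((SLPStates P).getD (m : ℕ) (fun _ => none)) i ≠ none ∧
        ((SLPStates P).getD (m : ℕ) (fun _ => none)) j ≠ none

/-- The program computes `t` if at some point during execution a register holds `t`. -/
def SLPComputes {S : Type*} [Semigroup S] {w : ℕ} (P : List (SLPInstr S w)) (t : S) : Prop :=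
  ∃ st ∈ SLPStates P, ∃ k : Fin w, st k = some t

inductive ProdN {S : Type*} [Semigroup S] (Sig : Set S) : ℕ → S → Prop
  | one (s : S) : s ∈ Sig → ProdN Sig 1 s
  | snoc (n : ℕ) (u s : S) : ProdN Sig n u → s ∈ Sig → ProdN Sig (n + 1) (u * s)

theorem ProdN.pos {S : Type*} [Semigroup S] {Sig : Set S} {n : ℕ} {t : S}
    (h : ProdN Sig n t) : 1 ≤ n := by
  cases h <;> omega

theorem ProdN.mul {S : Type*} [Semigroup S] {Sig : Set S} {m n : ℕ} {a b : S}
    (ha : ProdN Sig m a) (hb : ProdN Sig n b) : ProdN Sig (m + n) (a * b) := by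
  induction hb with
  | one s hs => exact .snoc _ _ _ ha hs
  | snoc n u s _ hs ih =>
    rw [← mul_assoc]
    exact .snoc _ _ _ ih hs

theorem ProdN.mono {S : Type*} [Semigroup S] {Sig : Set S} {n : ℕ} {a : S}
    (ha : ProdN Sig n a) : ProdN Set.univ n a := by
  induction ha with
  | one s hs => exact .one _ trivial
  | snoc n u s _ hs ih => exact .snoc _ _ _ ih trivial

theorem ProdN.split {S : Type*} [Semigroup S] {Sig : Set S} {N : ℕ} {t : S}
    (h : ProdN Sig N t) : ∀ m n, N = m + n → 1 ≤ m → 1 ≤ n →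
    ∃ a b, ProdN Sig m a ∧ ProdN Sig n b ∧ t = a * b := by
  induction h with
  | one s hs => intros; omega
  | snoc N u s hu hs ih =>
    intro m n h hm hn
    obtain rfl | hn' := Nat.eq_or_lt_of_le hn
    · obtain rfl : N = m := by omega
      exact ⟨u, s, hu, .one _ hs, rfl⟩
    · obtain ⟨a, b, ha, hb, rfl⟩ := ih m (n - 1) (by omega) hm (by omega)
      refine ⟨a, b * s, ha, ?_, mul_assoc _ _ _⟩
      have := ProdN.snoc _ _ _ hb hs
      rwa [Nat.sub_add_cancel hn] at this

theorem ProdN.down {S : Type*} [Semigroup S] {n k : ℕ} {t : S}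
    (h : ProdN Set.univ n t) (hk : 1 ≤ k) (hkn : k ≤ n) : ProdN Set.univ k t := by
  obtain rfl | hk' := Nat.eq_or_lt_of_le hk
  · exact .one _ trivial
  · obtain ⟨a, b, ha, hb, rfl⟩ := h.split (k - 1) (n - (k - 1)) (by omega) (by omega) (by omega)
    have := ProdN.snoc _ _ b ha trivial
    rwa [Nat.sub_add_cancel hk] at this

theorem listProd₁_snoc {S : Type*} [Semigroup S] (L : List S) : ∀ a s : S,
    listProd₁ a (L ++ [s]) = listProd₁ a L * s := by
  induction L with
  | nil => intro a s; rfl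
  | cons b L ih => intro a s; exact ih _ _

theorem ProdN.powSet {S : Type*} [Semigroup S] {Sig : Set S} {n : ℕ} {t : S}
    (h : ProdN Sig n t) : t ∈ powSet S n := by
  induction h with
  | one s hs => exact ⟨s, [], rfl, rfl⟩
  | snoc n u s _ _ ih =>
    obtain ⟨a, L, hL, rfl⟩ := ih
    exact ⟨a, L ++ [s], by simp [hL], listProd₁_snoc _ _ _⟩

theorem ProdN.of_closure {S : Type*} [Semigroup S] {Sig : Set S} {t : S}
    (h : t ∈ Subsemigroup.closure Sig) : ∃ n, ProdN Sig n t := by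
  induction h using Subsemigroup.closure_induction with
  | mem x hx => exact ⟨1, .one _ hx⟩
  | mul x y _ _ hx hy =>
    obtain ⟨m, hm⟩ := hx
    obtain ⟨n, hn⟩ := hy
    exact ⟨_, hm.mul hn⟩

theorem SLPStates_getD {S : Type*} [Semigroup S] {w : ℕ} (P : List (SLPInstr S w)) (m : ℕ)
    (hm : m ≤ P.length) :
    (SLPStates P).getD m (fun _ => none) = (P.take m).foldl SLPStep (fun _ => none) := by
  have hl : m < (SLPStates P).length := by
    simp only [SLPStates, List.length_scanl]; omega
  rw [List.getD_eq_getElem _ _ hl]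
  simp [SLPStates, List.getElem_scanl]

/-- The side condition of one instruction in a given state. -/
def InstrOK {S : Type*} {w : ℕ} (Sig : Set S) (st : Fin w → Option S) : SLPInstr S w → Prop
  | .load _ s => s ∈ Sig
  | .mul _ i j => st i ≠ none ∧ st j ≠ none

theorem SLPValid_iff {S : Type*} [Semigroup S] {w : ℕ} (Sig : Set S) (P : List (SLPInstr S w)) :
    SLPValid Sig P ↔ ∀ m (hm : m < P.length),
      InstrOK Sig ((P.take m).foldl SLPStep (fun _ => none)) P[m] := by
  unfold SLPValid
  rw [Fin.forall_iff]
  refine forall₂_congr fun m hm => ?_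
  rw [← SLPStates_getD P m hm.le]
  simp only [List.get_eq_getElem]
  cases P[m] <;> rfl

theorem SLPValid_snoc {S : Type*} [Semigroup S] {w : ℕ} {Sig : Set S} {P : List (SLPInstr S w)}
    {i : SLPInstr S w} (hP : SLPValid Sig P)
    (hi : InstrOK Sig (P.foldl SLPStep (fun _ => none)) i) : SLPValid Sig (P ++ [i]) := by
  rw [SLPValid_iff] at hP ⊢
  intro m hm
  by_cases h : m < P.length
  · rw [List.getElem_append_left h, List.take_append_of_le_length h.le]
    exact hP m h
  · obtain rfl : m = P.length := by
      simp at hm; omega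
    simpa using hi

theorem ProdN.program {S : Type*} [Semigroup S] {Sig : Set S} {n : ℕ} {t : S}
    (h : ProdN Sig n t) : ∃ P : List (SLPInstr S 2), SLPValid Sig P ∧
      P.foldl SLPStep (fun _ => none) 0 = some t ∧ P.length + 1 = 2 * n := by
  induction h with
  | one s hs =>
    refine ⟨[] ++ [.load 0 s], SLPValid_snoc (P := []) (i := .load 0 s) (fun m => m.elim0) hs, ?_, rfl⟩
    simp [SLPStep]
  | snoc n u s _ hs ih =>
    obtain ⟨P, hP, hu, hl⟩ := ih
    refine ⟨P ++ [.load 1 s] ++ [.mul 0 0 1], SLPValid_snoc (SLPValid_snoc (i := .load 1 s) hP hs) ?_, ?_, ?_⟩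
    · simp [InstrOK, SLPStep, hu]
    · simp [SLPStep, hu]
    · simp; omega

/-- if `S^k` is a rectangular band, then every element of the subsemigroup
generated by `Sig` is computed by a straight-line program of width 2 and length `≤ 6k − 3`. -/
theorem rectangular_band_power_width_two_bounded_length
    (k : ℕ) (hk : 1 ≤ k) (S : Type*) [Semigroup S] [Fintype S]
    (h1 : ∀ a ∈ powSet S k, a * a = a)
    (h2 : ∀ a ∈ powSet S k, ∀ b ∈ powSet S k, ∀ c ∈ powSet S k, a * b * c = a * c)
    (Sig : Set S) (t : S) (ht : t ∈ Subsemigroup.closure Sig) :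
    ∃ P : List (SLPInstr S 2), SLPValid Sig P ∧ SLPComputes P t ∧ P.length ≤ 6 * k - 3 := by
  obtain ⟨n, hn⟩ := ProdN.of_closure ht
  have key : ∃ m, m ≤ 3 * k - 1 ∧ ProdN Sig m t := by
    by_cases hnk : n ≤ 3 * k - 1
    · exact ⟨n, hnk, hn⟩
    · obtain ⟨a, b, ha, hb, rfl⟩ := hn.split k (n - k) (by omega) hk (by omega)
      obtain ⟨c, d, hc, hd, rfl⟩ := hb.split (n - k - k) k (by omega) (by omega) hk
      refine ⟨k + k, by omega, ?_⟩
      rw [← mul_assoc, h2 a ha.powSet c (hc.mono.down hk (by omega)).powSet d hd.powSet]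
      exact ha.mul hd
  obtain ⟨m, hm, h⟩ := key
  obtain ⟨P, hP, hf, hl⟩ := h.program
  refine ⟨P, hP, ⟨_, ?_, 0, hf⟩, by omega⟩
  have := SLPStates_getD P P.length le_rfl
  have hlt : P.length < (SLPStates P).length := by simp [SLPStates]
  rw [List.take_length, List.getD_eq_getElem _ _ hlt] at this
  rw [← this]
  exact List.getElem_mem _
end

section
/- There exists a constant C > 0 such that for every finite solvable group G, every subset Σ ⊆ G, and every t in the subsemigroup of G generated by Σ, there is a straight-line sequence over Σ of length at most C·(log₂|G| + 1) computing t. -/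
/-- A straight-line sequence over `Sig` in a semigroup: every entry is either a
generator from `Sig` or a product of two earlier entries. -/
def IsSLSeq {S : Type*} [Semigroup S] (Sig : Set S) (L : List S) : Prop :=
  ∀ m : Fin L.length, L.get m ∈ Sig ∨
    ∃ i j : Fin L.length, (i : ℕ) < (m : ℕ) ∧ (j : ℕ) < (m : ℕ) ∧ L.get m = L.get i * L.get j

/-- The straight-line cost of `t` over `Sig`: the minimal length of a straight-line
sequence over `Sig` containing `t`. -/
noncomputable def slCost {S : Type*} [Semigroup S] (Sig : Set S) (t : S) : ℕ :=
  sInf { n : ℕ | ∃ L : List S, IsSLSeq Sig L ∧ t ∈ L ∧ L.length = n }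



theorem nak {V : Type*} [AddCommGroup V] [Finite V] (F : Set (AddMonoid.End V))
    (hF : ∀ f ∈ F, ∀ g ∈ F, f * g = g * f)
    (htop : ∀ W : AddSubgroup V, (∀ f ∈ F, ∀ v, f v ∈ W) → W = ⊤)
    (v : V) (hv : ∀ f ∈ F, f v = 0) : v = 0 := by
  let _ : CommRing (Subring.closure F) := Subring.closureCommRingOfComm hF
  let R := Subring.closure F
  let _ : Module R V := inferInstance
  let I : Ideal R := Ideal.span {r : R | (r : AddMonoid.End V) ∈ F}
  have h1 : (⊤ : Submodule R V) ≤ I • (⊤ : Submodule R V) := by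
    have := htop (I • (⊤ : Submodule R V)).toAddSubgroup (by
      intro f hf v
      have : (⟨f, Subring.subset_closure hf⟩ : R) • v ∈ I • (⊤ : Submodule R V) :=
        Submodule.smul_mem_smul (Ideal.subset_span hf) trivial
      exact this)
    intro x _
    have hx : x ∈ (I • (⊤ : Submodule R V)).toAddSubgroup := by rw [this]; trivial
    exact hx
  obtain ⟨r, hr, hr0⟩ := Submodule.exists_sub_one_mem_and_smul_eq_zero_of_fg_of_le_smul I
    (⊤ : Submodule R V) (Module.Finite.fg_top) h1
  have h2 : ∀ i ∈ I, i • v = 0 := by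
    intro i hi
    induction hi using Submodule.span_induction with
    | mem x hx => exact hv _ hx
    | zero => exact zero_smul _ _
    | add x y _ _ hx hy => rw [add_smul, hx, hy, add_zero]
    | smul a x _ hx => rw [smul_assoc, hx, smul_zero]
  have h3 := h2 _ hr
  rw [sub_smul, hr0 v trivial, one_smul, zero_sub, neg_eq_zero] at h3
  exact h3

theorem nakG {G : Type*} [Group G] [Finite G] (V : Subgroup G) [hn : V.Normal]
    (hV : ∀ a ∈ V, ∀ b ∈ V, a * b = b * a) (T : Set G)
    (hT : ∀ a ∈ T, ∀ b ∈ T, a * b = b * a)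
    (hW : ∀ W : Subgroup G, W ≤ V → (∀ t ∈ T, ∀ v ∈ V, t * v * t⁻¹ * v⁻¹ ∈ W) → V ≤ W)
    (v : G) (hv : v ∈ V) (hc : ∀ t ∈ T, t * v = v * t) : v = 1 := by
  let _ : CommGroup V := { mul_comm := fun a b => Subtype.ext (hV a a.2 b b.2) }
  let f : G → (V →* V) := fun t =>
    { toFun := fun v => ⟨t * v * t⁻¹ * (v : G)⁻¹,
        V.mul_mem (hn.conj_mem _ v.2 t) (V.inv_mem v.2)⟩
      map_one' := by ext; simp
      map_mul' := by
        intro a b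
        ext
        have h1 := hV _ (V.inv_mem b.2) _ (V.inv_mem a.2)
        have h2 := hV _ (hn.conj_mem _ b.2 t) _ (V.inv_mem a.2)
        simp only [Subgroup.coe_mul, mul_inv_rev]
        calc t * (a * b : G) * t⁻¹ * ((b : G)⁻¹ * (a : G)⁻¹)
            = t * a * t⁻¹ * (t * b * t⁻¹) * ((b : G)⁻¹ * (a : G)⁻¹) := by group
          _ = t * a * t⁻¹ * ((t * b * t⁻¹) * (a : G)⁻¹) * (b : G)⁻¹ := by rw [h1]; group
          _ = _ := by rw [h2]; group }
  let F : Set (AddMonoid.End (Additive V)) := (fun t => MonoidHom.toAdditive (f t)) '' T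
  have key := nak F (by
    rintro _ ⟨a, ha, rfl⟩ _ ⟨b, hb, rfl⟩
    ext x
    have hab := hT a ha b hb
    obtain ⟨x, hx⟩ := x
    have h1 := hV _ (hn.conj_mem _ hx a) _ (hn.conj_mem _ hx b)
    have h1' : (a * x * a⁻¹)⁻¹ * (b * x * b⁻¹)⁻¹ = (b * x * b⁻¹)⁻¹ * (a * x * a⁻¹)⁻¹ := by
      rw [← mul_inv_rev, ← mul_inv_rev, h1]
    have h3 : a * b * x * b⁻¹ * a⁻¹ = b * a * x * a⁻¹ * b⁻¹ := by
      rw [hab]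
      have : b⁻¹ * a⁻¹ = a⁻¹ * b⁻¹ := by rw [← mul_inv_rev, ← mul_inv_rev, hab]
      rw [mul_assoc, this]; group
    change a * (b * x * b⁻¹ * x⁻¹) * a⁻¹ * (b * x * b⁻¹ * x⁻¹)⁻¹
      = b * (a * x * a⁻¹ * x⁻¹) * b⁻¹ * (a * x * a⁻¹ * x⁻¹)⁻¹
    have A := hV _ (V.inv_mem (hn.conj_mem _ hx a)) x hx
    have B := hV _ (V.inv_mem (hn.conj_mem _ hx b)) x hx
    calc a * (b * x * b⁻¹ * x⁻¹) * a⁻¹ * (b * x * b⁻¹ * x⁻¹)⁻¹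
        = (a * b * x * b⁻¹ * a⁻¹) * ((a * x * a⁻¹)⁻¹ * (x * (b * x * b⁻¹)⁻¹)) := by group
      _ = (a * b * x * b⁻¹ * a⁻¹) * (((a * x * a⁻¹)⁻¹ * (b * x * b⁻¹)⁻¹) * x) := by
          rw [← B]; group
      _ = (b * a * x * a⁻¹ * b⁻¹) * ((b * x * b⁻¹)⁻¹ * ((a * x * a⁻¹)⁻¹ * x)) := by
          rw [h1', h3]; group
      _ = _ := by rw [A]; group)
    (by
      intro W hWF
      have := hW ((AddSubgroup.toSubgroup' W).map V.subtype) (Subgroup.map_subtype_le _) (by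
        intro t ht v hv
        exact ⟨f t ⟨v, hv⟩, hWF _ ⟨t, ht, rfl⟩ (Additive.ofMul ⟨v, hv⟩), rfl⟩)
      rw [eq_top_iff]
      rintro ⟨x, hx⟩ _
      obtain ⟨y, hy, hyx⟩ := this hx
      have : y = ⟨x, hx⟩ := Subtype.ext hyx
      subst this
      exact hy)
    (Additive.ofMul ⟨v, hv⟩) (by
      rintro _ ⟨t, ht, rfl⟩
      change f t ⟨v, hv⟩ = 1
      ext
      change t * v * t⁻¹ * v⁻¹ = 1
      rw [hc t ht]; group)
  exact congrArg Subtype.val (show (⟨v, hv⟩ : V) = 1 from key)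

theorem normal_of_conj {G : Type*} [Group G] [Finite G] {Sig : Set G}
    (hS : Subgroup.closure Sig = ⊤) (U : Subgroup G)
    (h : ∀ s ∈ Sig, ∀ u ∈ U, s * u * s⁻¹ ∈ U) : U.Normal := by
  rw [← Subgroup.normalizer_eq_top_iff, eq_top_iff, ← hS, Subgroup.closure_le]
  intro s hs
  exact Subgroup.mem_normalizer_fintype (h s hs)

theorem conj_closure {G : Type*} [Group G] (s : G) (T : Set G) (U : Subgroup G)
    (h : ∀ u ∈ T, s * u * s⁻¹ ∈ U) : ∀ u ∈ Subgroup.closure T, s * u * s⁻¹ ∈ U := by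
  have : Subgroup.closure T ≤ U.comap (MulAut.conj s).toMonoidHom := by
    rw [Subgroup.closure_le]
    intro u hu
    exact h u hu
  intro u hu
  exact this hu

/-- The key lemma, modulo the normal subgroup. -/
theorem keyA {G : Type*} [Group G] [Finite G] {Sig : Set G}
    (hS : Subgroup.closure Sig = ⊤) (K : Subgroup G) [hK : K.Normal] (T : Set G)
    (hTK : Subgroup.closure T ⊔ ⁅K, K⁆ = K)
    (hab : ∀ a ∈ ⁅K, K⁆, ∀ b ∈ ⁅K, K⁆, a * b = b * a)
    (h1 : ∀ a ∈ T, ∀ b ∈ T, a * b = b * a)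
    (h2 : ∀ s ∈ Sig, ∀ a ∈ T, ∀ b ∈ T, (s * a * s⁻¹) * b = b * (s * a * s⁻¹)) :
    ⁅K, K⁆ = ⊥ := by
  set V := ⁅K, K⁆ with hVdef
  set T0 := Subgroup.closure T with hT0
  have hVn : V.Normal := by rw [hVdef]; infer_instance
  have cl : ∀ x : G, (∀ b ∈ T, x * b = b * x) → ∀ b ∈ T0, x * b = b * x := by
    intro x hx
    have : T0 ≤ Subgroup.centralizer {x} := by
      rw [hT0, Subgroup.closure_le]
      intro b hb
      simp only [SetLike.mem_coe, Subgroup.mem_centralizer_singleton_iff]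
      exact (hx b hb).symm
    intro b hb
    exact (Subgroup.mem_centralizer_singleton_iff.1 (this hb)).symm
  have c1 : ∀ a ∈ T0, ∀ b ∈ T0, a * b = b * a := by
    intro a ha
    apply cl
    intro b hb
    exact (cl b (fun c hc => h1 b hb c hc) a ha).symm
  have fac : ∀ x ∈ K, ∃ t ∈ T0, ∃ v ∈ V, t * v = x := by
    intro x hx
    rw [← hTK] at hx
    exact Subgroup.mem_sup_of_normal_right.1 hx
  have gen : ∀ W : Subgroup G, W ≤ V →
      (∀ t ∈ (T0 : Set G), ∀ v ∈ V, t * v * t⁻¹ * v⁻¹ ∈ W) → V ≤ W := by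
    intro W0 hWV0 hW0
    let W := Subgroup.closure {x | ∃ t ∈ T0, ∃ v ∈ V, t * v * t⁻¹ * v⁻¹ = x}
    have hWW0 : W ≤ W0 := by
      rw [Subgroup.closure_le]
      rintro _ ⟨t, ht, v, hv, rfl⟩
      exact hW0 t ht v hv
    have hWV : W ≤ V := hWW0.trans hWV0
    have hW : ∀ t ∈ T0, ∀ v ∈ V, t * v * t⁻¹ * v⁻¹ ∈ W := fun t ht v hv =>
      Subgroup.subset_closure ⟨t, ht, v, hv, rfl⟩
    have hWc : ∀ r ∈ T0, ∀ w ∈ W, r * w * r⁻¹ ∈ W := by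
      intro r hr
      apply conj_closure
      rintro _ ⟨t, ht, v, hv, rfl⟩
      have := hW t ht _ (hVn.conj_mem v hv r)
      have e : t * (r * v * r⁻¹) * t⁻¹ * (r * v * r⁻¹)⁻¹
          = (t * r) * v * (r⁻¹ * t⁻¹) * (r * v⁻¹ * r⁻¹) := by group
      have e2 : r⁻¹ * t⁻¹ = t⁻¹ * r⁻¹ := by
        rw [← mul_inv_rev, ← mul_inv_rev, c1 t ht r hr]
      rw [e, c1 t ht r hr, e2] at this
      convert this using 1
      group
    refine le_trans ?_ hWW0
    rw [hVdef, Subgroup.commutator_le]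
    intro x hx y hy
    obtain ⟨t, ht, v, hv, rfl⟩ := fac x hx
    obtain ⟨r, hr, w, hw, rfl⟩ := fac y hy
    have m1 := hW r⁻¹ (T0.inv_mem hr) v hv
    have m2 := W.inv_mem (hW t⁻¹ (T0.inv_mem ht) w hw)
    have m3 := hWc _ (T0.mul_mem ht hr) _ (W.mul_mem m1 m2)
    convert m3 using 1
    rw [commutatorElement_def]
    have q : v⁻¹ * w = w * v⁻¹ := hab _ (V.inv_mem hv) _ hw
    have tr := c1 t ht r hr
    have tr' : t⁻¹ * r⁻¹ = r⁻¹ * t⁻¹ := by rw [← mul_inv_rev, ← mul_inv_rev, tr]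
    calc t * v * (r * w) * (t * v)⁻¹ * (r * w)⁻¹
        = t * r * (r⁻¹ * v * r) * (w * v⁻¹) * t⁻¹ * w⁻¹ * r⁻¹ := by group
      _ = t * r * (r⁻¹ * v * r) * (v⁻¹ * w) * t⁻¹ * w⁻¹ * t * (t⁻¹ * r⁻¹) := by rw [q]; group
      _ = _ := by rw [tr']; group
  have fix : ∀ v ∈ V, (∀ t ∈ T0, t * v = v * t) → v = 1 := fun v hv hc =>
    nakG V hab (T0 : Set G) c1 gen v hv hc
  have hT0n : T0.Normal := by
    apply normal_of_conj hS
    intro s hs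
    apply conj_closure
    intro u hu
    have huK : u ∈ K := by
      rw [← hTK]; exact Subgroup.mem_sup_left (Subgroup.subset_closure hu)
    obtain ⟨h, hh, w, hw, e⟩ := fac _ (hK.conj_mem u huK s)
    have hc := cl _ (h2 s hs u hu)
    have : w = 1 := by
      apply fix w hw
      intro t ht
      have e1 := hc t ht
      rw [← e] at e1
      have e2 := c1 h hh t ht
      have : h * (w * t) = h * (t * w) := by
        rw [← mul_assoc, e1, ← mul_assoc, ← mul_assoc, e2]
      exact (mul_left_cancel this).symm
    rw [← e, this, mul_one]
    exact hh
  rw [eq_bot_iff]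
  apply gen ⊥ bot_le
  intro t ht v hv
  rw [Subgroup.mem_bot]
  apply fix
  · exact V.mul_mem (hVn.conj_mem v hv t) (V.inv_mem hv)
  · intro r hr
    apply c1 r hr
    have := T0.mul_mem ht (hT0n.conj_mem _ (T0.inv_mem ht) v)
    convert this using 1
    group

/-- The key lemma: few commutators normally generate the next derived layer. -/
theorem keyB {G : Type*} [Group G] [Finite G] {Sig : Set G}
    (hS : Subgroup.closure Sig = ⊤) (K : Subgroup G) [hK : K.Normal] (T : Set G)
    (hTK : Subgroup.closure T ⊔ ⁅K, K⁆ = K) (M : Subgroup G) [hM : M.Normal]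
    (hKM : ⁅⁅K, K⁆, ⁅K, K⁆⁆ ≤ M)
    (h1 : ∀ a ∈ T, ∀ b ∈ T, a * b * a⁻¹ * b⁻¹ ∈ M)
    (h2 : ∀ s ∈ Sig, ∀ a ∈ T, ∀ b ∈ T, (s * a * s⁻¹) * b * (s * a * s⁻¹)⁻¹ * b⁻¹ ∈ M) :
    ⁅K, K⁆ ≤ M := by
  let q := QuotientGroup.mk' M
  have hq : Function.Surjective q := QuotientGroup.mk'_surjective M
  have hker : ∀ x, q x = 1 ↔ x ∈ M := fun x => QuotientGroup.eq_one_iff x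
  have hcomm : ∀ a b : G, a * b * a⁻¹ * b⁻¹ ∈ M → q a * q b = q b * q a := by
    intro a b h
    rw [← hker] at h
    simp only [map_mul, map_inv] at h
    rw [mul_inv_eq_one, mul_inv_eq_iff_eq_mul] at h
    exact h
  have : (K.map q).Normal := hK.map q hq
  have main := keyA (Sig := q '' Sig) (by
      rw [← MonoidHom.map_closure, hS, ← MonoidHom.range_eq_map, MonoidHom.range_eq_top.2 hq])
    (K.map q) (q '' T) (by
      rw [← MonoidHom.map_closure, ← Subgroup.map_commutator, ← Subgroup.map_sup, hTK])
    (by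
      rw [← Subgroup.map_commutator]
      rintro _ ⟨a, ha, rfl⟩ _ ⟨b, hb, rfl⟩
      exact hcomm a b (hKM (Subgroup.commutator_mem_commutator ha hb)))
    (by
      rintro _ ⟨a, ha, rfl⟩ _ ⟨b, hb, rfl⟩
      exact hcomm a b (h1 a ha b hb))
    (by
      rintro _ ⟨s, hs, rfl⟩ _ ⟨a, ha, rfl⟩ _ ⟨b, hb, rfl⟩
      have := hcomm _ b (h2 s hs a ha b hb)
      simpa using this)
  rw [← Subgroup.map_commutator] at main
  intro x hx
  rw [← hker, ← Subgroup.mem_bot, ← main]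
  exact ⟨x, hx, rfl⟩

/-- Straight-line lists (latest entry first); inversions are allowed when `I` holds. -/
inductive St {G : Type*} [Group G] (Sig : Set G) (I : Prop) : List G → Prop
  | nil : St Sig I []
  | gen (x : G) (L : List G) : St Sig I L → x ∈ Sig → St Sig I (x :: L)
  | mul (a b : G) (L : List G) : St Sig I L → a ∈ L → b ∈ L → St Sig I (a * b :: L)
  | inv (a : G) (L : List G) : St Sig I L → I → a ∈ L → St Sig I (a⁻¹ :: L)

theorem St.toSeq {G : Type*} [Group G] {Sig : Set G} {L : List G} (h : St Sig False L) :
    IsSLSeq Sig L.reverse := by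
  have step : ∀ (x : G) (L : List G), IsSLSeq Sig L.reverse →
      (x ∈ Sig ∨ ∃ a ∈ L, ∃ b ∈ L, x = a * b) → IsSLSeq Sig (x :: L).reverse := by
    intro x L ih hx
    rw [List.reverse_cons]
    intro m
    have hm := m.2
    simp only [List.length_append, List.length_cons, List.length_nil] at hm
    by_cases hlt : (m : ℕ) < L.reverse.length
    · have := ih ⟨m, hlt⟩
      simp only [List.get_eq_getElem] at this ⊢
      rw [List.getElem_append_left hlt]
      rcases this with h | ⟨i, j, hi, hj, h⟩
      · exact Or.inl h
      · right
        refine ⟨⟨i, by have := i.2; simp at this ⊢; omega⟩,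
          ⟨j, by have := j.2; simp at this ⊢; omega⟩, hi, hj, ?_⟩
        rw [List.getElem_append_left i.2, List.getElem_append_left j.2]
        exact h
    · have hme : (m : ℕ) = L.reverse.length := by omega
      have e : (L.reverse ++ [x]).get m = x := by
        simp only [List.get_eq_getElem]
        rw [List.getElem_append_right (by omega)]
        simp
      rw [e]
      rcases hx with h | ⟨a, ha, b, hb, h⟩
      · exact Or.inl h
      · right
        obtain ⟨i, hi, ea⟩ := List.getElem_of_mem (List.mem_reverse.2 ha)
        obtain ⟨j, hj, eb⟩ := List.getElem_of_mem (List.mem_reverse.2 hb)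
        refine ⟨⟨i, by simp at hi ⊢; omega⟩, ⟨j, by simp at hj ⊢; omega⟩,
          by simp only; omega, by simp only; omega, ?_⟩
        simp only [List.get_eq_getElem]
        rw [List.getElem_append_left hi, List.getElem_append_left hj, ea, eb, h]
  induction h with
  | nil => intro m; exact absurd m.2 (by simp)
  | gen x L _ hx ih => exact step x L ih (Or.inl hx)
  | mul a b L _ ha hb ih => exact step _ L ih (Or.inr ⟨a, ha, b, hb, rfl⟩)
  | inv a L _ hI => exact hI.elim

/-- Extension of a straight-line list by at most `n` further entries. -/
def Ex {G : Type*} [Group G] (Sig : Set G) (I : Prop) (L : List G) (n : ℕ) (L' : List G) : Prop :=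
  St Sig I L' ∧ L ⊆ L' ∧ L'.length ≤ L.length + n

theorem Ex.trans {G : Type*} [Group G] {Sig : Set G} {I : Prop} {L L' L'' : List G} {m n : ℕ}
    (h : Ex Sig I L m L') (h' : Ex Sig I L' n L'') : Ex Sig I L (m + n) L'' :=
  ⟨h'.1, List.Subset.trans h.2.1 h'.2.1, by have := h.2.2; have := h'.2.2; omega⟩

theorem Ex.mono {G : Type*} [Group G] {Sig : Set G} {I : Prop} {L L' : List G} {m n : ℕ}
    (h : Ex Sig I L m L') (hmn : m ≤ n) : Ex Sig I L n L' :=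
  ⟨h.1, h.2.1, by have := h.2.2; omega⟩

theorem Ex.refl {G : Type*} [Group G] {Sig : Set G} {I : Prop} {L : List G} (h : St Sig I L) :
    Ex Sig I L 0 L := ⟨h, fun _ h => h, le_rfl⟩

theorem Ex.mul {G : Type*} [Group G] {Sig : Set G} {I : Prop} {L : List G} (h : St Sig I L)
    {a b : G} (ha : a ∈ L) (hb : b ∈ L) : Ex Sig I L 1 (a * b :: L) :=
  ⟨.mul a b L h ha hb, List.subset_cons_self _ _, by simp⟩

theorem Ex.gen {G : Type*} [Group G] {Sig : Set G} {I : Prop} {L : List G} (h : St Sig I L)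
    {a : G} (ha : a ∈ Sig) : Ex Sig I L 1 (a :: L) :=
  ⟨.gen a L h ha, List.subset_cons_self _ _, by simp⟩

theorem Ex.inv {G : Type*} [Group G] {Sig : Set G} {L : List G} (h : St Sig True L)
    {a : G} (ha : a ∈ L) : Ex Sig True L 1 (a⁻¹ :: L) :=
  ⟨.inv a L h trivial ha, List.subset_cons_self _ _, by simp⟩

theorem Ex.pow {G : Type*} [Group G] {Sig : Set G} {I : Prop} (m : ℕ) :
    ∀ (e : ℕ), e < 2 ^ m → ∀ (L : List G), St Sig I L → ∀ y ∈ L, ∀ g ∈ L,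
      ∃ L', Ex Sig I L (2 * m) L' ∧ y * g ^ e ∈ L' := by
  induction m with
  | zero =>
    intro e he L hL y hy g _
    have : e = 0 := by simpa using he
    subst this
    exact ⟨L, Ex.refl hL, by simpa using hy⟩
  | succ m ih =>
    intro e he L hL y hy g hg
    have h2 : Ex Sig I L 1 (g * g :: L) := Ex.mul hL hg hg
    have hpow : (g * g) ^ (e / 2) = g ^ (2 * (e / 2)) := by rw [← pow_two, ← pow_mul]
    have hlt : e / 2 < 2 ^ m := by rw [pow_succ] at he; omega
    rcases Nat.even_or_odd e with hp | hp
    · obtain ⟨L', hL', hm⟩ := ih (e / 2) hlt _ h2.1 y (by simp [hy]) (g * g) (by simp)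
      refine ⟨L', (h2.trans hL').mono (by omega), ?_⟩
      rwa [hpow, Nat.two_mul_div_two_of_even hp] at hm
    · have h3 := Ex.mul h2.1 (a := y) (b := g) (by simp [hy]) (by simp [hg])
      obtain ⟨L', hL', hm⟩ := ih (e / 2) hlt _ h3.1 (y * g) (by simp) (g * g) (by simp)
      refine ⟨L', ((h2.trans h3).trans hL').mono (by omega), ?_⟩
      rwa [hpow, mul_assoc, ← pow_succ', Nat.two_mul_div_two_add_one_of_odd hp] at hm

theorem Ex.conj {G : Type*} [Group G] {Sig : Set G} {L : List G} (h : St Sig True L)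
    {s a : G} (hs : s ∈ Sig) (ha : a ∈ L) :
    ∃ L', Ex Sig True L 4 L' ∧ s * a * s⁻¹ ∈ L' := by
  have h1 := Ex.gen h hs
  have h2 := h1.trans (Ex.inv h1.1 (a := s) (by simp))
  have h3 := h2.trans (Ex.mul h2.1 (a := s) (b := a) (by simp) (by simp [ha]))
  have h4 := h3.trans (Ex.mul h3.1 (a := s * a) (b := s⁻¹) (by simp) (by simp))
  exact ⟨_, h4, by simp⟩

theorem Ex.comm {G : Type*} [Group G] {Sig : Set G} {L : List G} (h : St Sig True L)
    {a b : G} (hb : b ∈ L) (ha : a ∈ L) :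
    ∃ L', Ex Sig True L 5 L' ∧ a * b * a⁻¹ * b⁻¹ ∈ L' := by
  have h1 := Ex.inv h ha
  have h2 := h1.trans (Ex.inv h1.1 (a := b) (by simp [hb]))
  have h3 := h2.trans (Ex.mul h2.1 (a := a) (b := b) (by simp [ha]) (by simp [hb]))
  have h4 := h3.trans (Ex.mul h3.1 (a := a * b) (b := a⁻¹) (by simp) (by simp))
  have h5 := h4.trans (Ex.mul h4.1 (a := a * b * a⁻¹) (b := b⁻¹) (by simp) (by simp))
  exact ⟨_, h5, by simp⟩

/-- Batch inversion of generators. -/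
theorem batch {G : Type*} [Group G] {Sig : Set G} (l : List G) (hl : ∀ x ∈ l, x ∈ Sig) :
    ∀ (a : G) (B : List G), St Sig False B → a ∈ B →
      ∃ B1, Ex Sig False B (2 * l.length) B1 ∧ a * l.prod ∈ B1 ∧ l ⊆ B1 ∧
        ∀ B2, St Sig False B2 → B1 ⊆ B2 → (a * l.prod)⁻¹ ∈ B2 →
          ∃ B3, Ex Sig False B2 (2 * l.length) B3 ∧ a⁻¹ ∈ B3 ∧ ∀ s ∈ l, s⁻¹ ∈ B3 := by
  induction l with
  | nil =>
    intro a B hB ha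
    exact ⟨B, Ex.refl hB, by simpa using ha, by simp,
      fun B2 h2 _ hi => ⟨B2, Ex.refl h2, by simpa using hi, by simp⟩⟩
  | cons s l ih =>
    intro a B hB ha
    have e1 := Ex.gen hB (hl s (by simp))
    have e2 := e1.trans (Ex.mul e1.1 (a := a) (b := s) (by simp [ha]) (by simp))
    obtain ⟨B1, hB1, hp, hsub, hrest⟩ := ih (fun x hx => hl x (by simp [hx])) (a * s) _ e2.1 (by simp)
    have hsB : s ∈ B1 := hB1.2.1 (by simp)
    have haB : a ∈ B1 := hB1.2.1 (by simp [ha])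
    refine ⟨B1, (e2.trans hB1).mono (by simp; omega), by rwa [List.prod_cons, ← mul_assoc],
      List.cons_subset.2 ⟨hsB, hsub⟩, ?_⟩
    intro B2 h2 hB12 hi
    rw [List.prod_cons, ← mul_assoc] at hi
    obtain ⟨B3, h3, hi3, hall⟩ := hrest B2 h2 hB12 hi
    have f1 := Ex.mul h3.1 (a := s) (b := (a * s)⁻¹) (h3.2.1 (hB12 hsB)) hi3
    have f2 := f1.trans (Ex.mul f1.1 (a := (a * s)⁻¹) (b := a) (by simp only [List.mem_cons]; exact Or.inr hi3)
      (by simp only [List.mem_cons]; exact Or.inr (h3.2.1 (hB12 haB))))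
    refine ⟨_, (h3.trans f2).mono (by simp; omega), ?_, ?_⟩
    · have : s * (a * s)⁻¹ = a⁻¹ := by group
      rw [this]; simp
    · intro x hx
      rcases List.mem_cons.1 hx with rfl | hx
      · have : (a * x)⁻¹ * a = x⁻¹ := by group
        rw [this]; simp
      · simp [hall x hx]

/-- Elimination of inversions. -/
theorem elimInv {G : Type*} [Group G] [Finite G] {Sig : Set G} {s0 : G} (hs0 : s0 ∈ Sig)
    {L : List G} (h : St Sig True L) (m : ℕ) (hm : Nat.card G ≤ 2 ^ m) :
    ∃ B, St Sig False B ∧ L ⊆ B ∧ B.length ≤ 3 + 2 * m + 6 * L.length := by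
  classical
  let l := L.filter (fun x => decide (x ∈ Sig))
  have hlen : l.length ≤ L.length := List.length_filter_le _ _
  have hl : ∀ x ∈ l, x ∈ Sig := by
    intro x hx
    simpa using (List.mem_filter.1 hx).2
  have b0 := Ex.gen (I := False) St.nil hs0
  obtain ⟨B1, e1, hp, hsub, hrest⟩ := batch l hl s0 _ b0.1 (by simp)
  obtain ⟨B2, e2, hpow⟩ : ∃ B2, Ex Sig False B1 (2 * m + 2) B2 ∧ (s0 * l.prod)⁻¹ ∈ B2 := by
    have hpos : 0 < Nat.card G := Nat.card_pos
    obtain ⟨B2, e2, h2⟩ := Ex.pow (m + 1) (2 * Nat.card G - 2)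
      (by rw [pow_succ]; omega) B1 e1.1 _ hp _ hp
    refine ⟨B2, e2.mono (by omega), ?_⟩
    have : (s0 * l.prod) * (s0 * l.prod) ^ (2 * Nat.card G - 2) = (s0 * l.prod)⁻¹ := by
      rw [eq_inv_iff_mul_eq_one, ← pow_succ', ← pow_succ]
      have : 2 * Nat.card G - 2 + 1 + 1 = Nat.card G * 2 := by omega
      rw [this, pow_mul, pow_card_eq_one', one_pow]
    rwa [this] at h2
  obtain ⟨B3, e3, -, hinv⟩ := hrest B2 e2.1 e2.2.1 hpow
  have hB3len : B3.length ≤ 1 + 2 * m + 2 + 4 * L.length := by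
    have := (((b0.trans e1).trans e2).trans e3).2.2
    simp at this; omega
  have hB3 : ∀ x ∈ L, x ∈ Sig → x ∈ B3 ∧ x⁻¹ ∈ B3 := by
    intro x hx hxs
    have : x ∈ l := List.mem_filter.2 ⟨hx, by simpa using hxs⟩
    exact ⟨e3.2.1 (e2.2.1 (hsub this)), hinv x this⟩
  have main : ∀ L' : List G, St Sig True L' → (∀ x ∈ L', x ∈ Sig → x ∈ B3 ∧ x⁻¹ ∈ B3) →
      ∃ B, Ex Sig False B3 (2 * L'.length) B ∧ ∀ x ∈ L', x ∈ B ∧ x⁻¹ ∈ B := by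
    intro L' hL'
    induction hL' with
    | nil => intro _; exact ⟨B3, Ex.refl e3.1, by simp⟩
    | gen x L' _ hx ih =>
      intro hsig
      obtain ⟨B, hB, hall⟩ := ih (fun y hy => hsig y (by simp [hy]))
      refine ⟨B, hB.mono (by simp), ?_⟩
      intro y hy
      rcases List.mem_cons.1 hy with rfl | hy
      · have := hsig y (by simp) hx
        exact ⟨hB.2.1 this.1, hB.2.1 this.2⟩
      · exact hall y hy
    | mul a b L' _ ha hb ih =>
      intro hsig
      obtain ⟨B, hB, hall⟩ := ih (fun y hy => hsig y (by simp [hy]))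
      have f1 := hB.trans (Ex.mul hB.1 (hall a ha).1 (hall b hb).1)
      have f2 := f1.trans (Ex.mul f1.1 (a := b⁻¹) (b := a⁻¹)
        (List.mem_cons_of_mem _ (hall b hb).2) (List.mem_cons_of_mem _ (hall a ha).2))
      refine ⟨_, f2.mono (by simp; omega), ?_⟩
      intro y hy
      rcases List.mem_cons.1 hy with rfl | hy
      · simp
      · have := hall y hy
        simp [this.1, this.2]
    | inv a L' _ _ ha ih =>
      intro hsig
      obtain ⟨B, hB, hall⟩ := ih (fun y hy => hsig y (by simp [hy]))
      refine ⟨B, hB.mono (by simp), ?_⟩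
      intro y hy
      rcases List.mem_cons.1 hy with rfl | hy
      · simpa using (hall a ha).symm
      · exact hall y hy
  obtain ⟨B, hB, hall⟩ := main _ h hB3
  refine ⟨B, hB.1, fun x hx => (hall x hx).1, ?_⟩
  have := hB.2.2
  omega

open Pointwise in
theorem cyclicStep {G : Type*} [Group G] [Finite G] (U : Subgroup G) (g : G) (hg : g ∉ U)
    (hn : ∀ u ∈ U, g * u * g⁻¹ ∈ U) :
    ∃ n : ℕ, 2 ≤ n ∧ n * Nat.card U ≤ Nat.card (Subgroup.zpowers g ⊔ U : Subgroup G) ∧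
      ∀ x ∈ Subgroup.zpowers g ⊔ U, ∃ e < n, ∃ u ∈ U, x = g ^ e * u := by
  classical
  have hex : ∃ n, 0 < n ∧ g ^ n ∈ U :=
    ⟨orderOf g, orderOf_pos g, by rw [pow_orderOf_eq_one]; exact U.one_mem⟩
  let n := Nat.find hex
  obtain ⟨hn0, hnU⟩ : 0 < n ∧ g ^ n ∈ U := Nat.find_spec hex
  have hmin : ∀ k, 0 < k → g ^ k ∈ U → n ≤ k := fun k hk h => Nat.find_min' hex ⟨hk, h⟩
  have hnorm : Subgroup.zpowers g ≤ Subgroup.normalizer (U : Set G) := by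
    rw [Subgroup.zpowers_le]
    exact Subgroup.mem_normalizer_fintype hn
  refine ⟨n, ?_, ?_, ?_⟩
  · by_contra hlt
    have : n = 1 := by omega
    rw [this, pow_one] at hnU
    exact hg hnU
  · have hcard : n * Nat.card U = Nat.card (Fin n × U) := by simp
    rw [hcard]
    let f : Fin n × U → (Subgroup.zpowers g ⊔ U : Subgroup G) := fun p =>
      ⟨g ^ (p.1 : ℕ) * p.2, Subgroup.mul_mem _
        (Subgroup.mem_sup_left (Subgroup.npow_mem_zpowers g _)) (Subgroup.mem_sup_right p.2.2)⟩
    apply Nat.card_le_card_of_injective f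
    have aux : ∀ i j : ℕ, i ≤ j → j < n → ∀ u ∈ U, ∀ v ∈ U, g ^ i * u = g ^ j * v → i = j := by
      intro i j hij hj u hu v hv e
      by_contra hne
      have : g ^ (j - i) ∈ U := by
        have e2 : g ^ (j - i) = u * v⁻¹ := by
          have : g ^ j = g ^ i * g ^ (j - i) := by rw [← pow_add]; congr 1; omega
          rw [this, mul_assoc] at e
          rw [mul_left_cancel e]; group
        rw [e2]; exact U.mul_mem hu (U.inv_mem hv)
      have := hmin _ (by omega) this
      omega
    rintro ⟨i, u⟩ ⟨j, v⟩ e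
    have e' : g ^ (i : ℕ) * (u : G) = g ^ (j : ℕ) * (v : G) := congrArg Subtype.val e
    have hij : (i : ℕ) = j := by
      rcases le_total (i : ℕ) j with h | h
      · exact aux i j h j.2 u u.2 v v.2 e'
      · exact (aux j i h i.2 v v.2 u u.2 e'.symm).symm
    rw [hij] at e'
    have huv : u = v := Subtype.ext (mul_left_cancel e')
    rw [Fin.ext hij, huv]
  · intro x hx
    have hx' : x ∈ ((Subgroup.zpowers g : Set G) * (U : Set G)) := by
      rw [← Subgroup.coe_mul_of_left_le_normalizer_right _ _ hnorm]; exact hx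
    obtain ⟨y, hy, u, hu, rfl⟩ := hx'
    have hy' : y ∈ Submonoid.powers g := mem_powers_iff_mem_zpowers.2 hy
    obtain ⟨k, rfl⟩ := hy'
    refine ⟨k % n, Nat.mod_lt _ hn0, (g ^ n) ^ (k / n) * u,
      U.mul_mem (U.pow_mem hnU _) hu, ?_⟩
    change g ^ k * u = _
    rw [← mul_assoc, ← pow_mul, ← pow_add, Nat.mod_add_div]

/-- Binary logarithm of the order of a subgroup. -/
noncomputable def lg {G : Type*} [Group G] (U : Subgroup G) : ℝ := Real.logb 2 (Nat.card U)

theorem lg_step {G : Type*} [Group G] [Finite G] (U U' : Subgroup G) (n : ℕ) (hn : 2 ≤ n)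
    (h : n * Nat.card U ≤ Nat.card U') :
    1 ≤ lg U' - lg U ∧ (2 * Nat.clog 2 n : ℕ) ≤ 4 * (lg U' - lg U) := by
  have hU : (0 : ℝ) < Nat.card U := by exact_mod_cast Nat.card_pos
  have hn' : (2 : ℝ) ≤ n := by exact_mod_cast hn
  have h1 : Real.logb 2 n + lg U ≤ lg U' := by
    unfold lg
    rw [← Real.logb_mul (by positivity) (by positivity)]
    apply Real.logb_le_logb_of_le (by norm_num) (by positivity)
    exact_mod_cast h
  have h2 : 1 ≤ Real.logb 2 n := by
    rw [Real.le_logb_iff_rpow_le (by norm_num) (by positivity)]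
    simpa using hn'
  have h3 : (Nat.clog 2 n : ℝ) ≤ Real.logb 2 n + 1 := by
    have := Nat.pow_pred_clog_lt_self (b := 2) (by norm_num) (x := n) (by omega)
    have hpos : 0 < Nat.clog 2 n := Nat.clog_pos (by norm_num) hn
    obtain ⟨c, hc⟩ : ∃ c, Nat.clog 2 n = c + 1 := ⟨_, (Nat.succ_pred_eq_of_pos hpos).symm⟩
    rw [hc, Nat.pred_succ] at this
    rw [hc]
    have h4 : (c : ℝ) ≤ Real.logb 2 n := by
      rw [Real.le_logb_iff_rpow_le (by norm_num) (by positivity), Real.rpow_natCast]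
      exact_mod_cast this.le
    push_cast; linarith
  constructor
  · linarith
  · push_cast; linarith

/-- Every element of `y0 U` can be computed modulo `N` at cost `r`. -/
def Cov {G : Type*} [Group G] (Sig : Set G) (U N : Subgroup G) (L : List G) (r : ℝ) : Prop :=
  ∀ L1, St Sig True L1 → L ⊆ L1 → ∀ y0 ∈ L1, ∀ u ∈ U,
    ∃ L2, St Sig True L2 ∧ L1 ⊆ L2 ∧ (L2.length : ℝ) ≤ L1.length + r ∧
      ∃ y ∈ L2, ∃ n ∈ N, y = y0 * u * n

theorem layer {G : Type*} [Group G] [Finite G] {Sig : Set G}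
    (hS : Subgroup.closure Sig = ⊤) (K N : Subgroup G) [hK : K.Normal] [hN : N.Normal]
    (hNK : N ≤ K) (hKN : ⁅K, K⁆ ≤ N) (E : Set G) (hEK : E ⊆ K) (L : List G)
    (hL : St Sig True L)
    (hE : ∀ L', St Sig True L' → L ⊆ L' → ∀ e ∈ E, ∃ L'', Ex Sig True L' 10 L'' ∧ e ∈ L'')
    (hgen : ∀ U : Subgroup G, U.Normal → N ≤ U → E ⊆ U → K ≤ U) :
    ∃ (L' : List G) (T : Set G), St Sig True L' ∧ L ⊆ L' ∧
      (L'.length : ℝ) + 10 * lg N ≤ L.length + 10 * lg K ∧ (∀ x ∈ T, x ∈ L') ∧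
      Subgroup.closure T ⊔ N = K ∧ Cov Sig K N L' (4 * (lg K - lg N)) := by
  let P : Set (Subgroup G) := {U | U ≤ K ∧ ∃ (L' : List G) (T : Set G), St Sig True L' ∧ L ⊆ L' ∧
      (L'.length : ℝ) + 10 * lg N ≤ L.length + 10 * lg U ∧ (∀ x ∈ T, x ∈ L') ∧
      Subgroup.closure T ⊔ N = U ∧ Cov Sig U N L' (4 * (lg U - lg N))}
  have hPN : N ∈ P := by
    refine ⟨hNK, L, ∅, hL, fun _ h => h, le_rfl, by simp, by simp, ?_⟩
    intro L1 h1 _ y0 hy0 u hu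
    exact ⟨L1, h1, fun _ h => h, by simp, y0, hy0, u⁻¹, N.inv_mem hu, by group⟩
  obtain ⟨U, hU, hmax⟩ := Set.Finite.exists_maximal (Set.toFinite P) ⟨N, hPN⟩
  obtain ⟨hUK, L', T, hL', hLL', hlen, hT, hTU, hcov⟩ := hU
  have hNU : N ≤ U := by rw [← hTU]; exact le_sup_right
  -- any cheap element of `K` already lies in `U`
  have cheap : ∀ g ∈ K, (∃ L'', Ex Sig True L' 10 L'' ∧ g ∈ L'') → g ∈ U := by
    rintro g hgK ⟨L'', hL'', hgL⟩
    by_contra hgU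
    have hnorm : ∀ u ∈ U, g * u * g⁻¹ ∈ U := by
      intro u hu
      have h1 : g * u * g⁻¹ * u⁻¹ ∈ U := hNU (hKN (Subgroup.commutator_mem_commutator hgK (hUK hu)))
      have := U.mul_mem h1 hu
      simpa using this
    obtain ⟨n, hn2, hcard, hfac⟩ := cyclicStep U g hgU hnorm
    obtain ⟨c1, c2⟩ := lg_step U _ n hn2 hcard
    have hmem : (Subgroup.zpowers g ⊔ U) ∈ P := by
      refine ⟨sup_le (by rwa [Subgroup.zpowers_le]) hUK, L'', insert g T, hL''.1,
        List.Subset.trans hLL' hL''.2.1, ?_, ?_, ?_, ?_⟩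
      · have : (L''.length : ℝ) ≤ L'.length + 10 := by exact_mod_cast hL''.2.2
        linarith
      · intro x hx
        rcases hx with rfl | hx
        · exact hgL
        · exact hL''.2.1 (hT x hx)
      · rw [Set.insert_eq, Subgroup.closure_union, sup_assoc, hTU, Subgroup.zpowers_eq_closure]
      · intro L1 h1 hs1 y0 hy0 x hx
        obtain ⟨e, he, u, hu, rfl⟩ := hfac x hx
        obtain ⟨L2, hL2, hy2⟩ := Ex.pow (Nat.clog 2 n) e
          (lt_of_lt_of_le he (Nat.le_pow_clog (by norm_num) n)) L1 h1 y0 hy0 g (hs1 hgL)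
        obtain ⟨L3, h3, hs3, hl3, y, hy, m, hm, rfl⟩ := hcov L2 hL2.1
          (List.Subset.trans hL''.2.1 (List.Subset.trans hs1 hL2.2.1)) _ hy2 u hu
        refine ⟨L3, h3, List.Subset.trans hL2.2.1 hs3, ?_, _, hy, m, hm, by group⟩
        have : (L2.length : ℝ) ≤ L1.length + (2 * Nat.clog 2 n : ℕ) := by exact_mod_cast hL2.2.2
        linarith
    exact hgU (hmax hmem le_sup_right (Subgroup.mem_sup_left (Subgroup.mem_zpowers g)))
  have hUn : U.Normal := by
    apply normal_of_conj hS
    intro s hs u hu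
    rw [← hTU] at hu
    obtain ⟨t, ht, m, hm, rfl⟩ := Subgroup.mem_sup_of_normal_right.1 hu
    have h1 : s * t * s⁻¹ ∈ U := by
      refine conj_closure s T U ?_ t ht
      intro u hu
      have huK : u ∈ K := hUK (by rw [← hTU]; exact Subgroup.mem_sup_left (Subgroup.subset_closure hu))
      refine cheap _ (hK.conj_mem u huK s) ?_
      obtain ⟨L'', h1, h2⟩ := Ex.conj hL' hs (hT u hu)
      exact ⟨L'', h1.mono (by norm_num), h2⟩
    have h2 := U.mul_mem h1 (hNU (hN.conj_mem m hm s))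
    convert h2 using 1
    group
  have hKU : K ≤ U := hgen U hUn hNU (fun e he => cheap e (hEK he) (hE L' hL' hLL' e he))
  have : U = K := le_antisymm hUK hKU
  subst this
  exact ⟨L', T, hL', hLL', hlen, hT, hTU, hcov⟩

theorem chain {G : Type*} [Group G] [Finite G] {Sig : Set G}
    (hS : Subgroup.closure Sig = ⊤) (L0 : List G) (hL0 : St Sig True L0) (k : ℕ) :
    ∃ (L : List G) (T : Set G), St Sig True L ∧ L0 ⊆ L ∧
      (L.length : ℝ) + 10 * lg (derivedSeries G (k + 1)) ≤ L0.length + 10 * lg (⊤ : Subgroup G) ∧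
      (∀ x ∈ T, x ∈ L) ∧
      Subgroup.closure T ⊔ derivedSeries G (k + 1) = derivedSeries G k ∧
      Cov Sig ⊤ (derivedSeries G (k + 1)) L
        (4 * (lg (⊤ : Subgroup G) - lg (derivedSeries G (k + 1)))) := by
  induction k with
  | zero =>
    have h := layer hS (derivedSeries G 0) (derivedSeries G 1)
      (by rw [derivedSeries_zero]; exact le_top) (by rw [derivedSeries_succ]) Sig
      (by rw [derivedSeries_zero]; simp) L0 hL0
      (fun L' hL' _ e he => ⟨_, (Ex.gen hL' he).mono (by norm_num), by simp⟩)
      (fun U _ _ hU => by rw [derivedSeries_zero, ← hS, Subgroup.closure_le]; exact hU)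
    simpa only [derivedSeries_zero, zero_add] using h
  | succ k ih =>
    obtain ⟨L, T, hL, hs, hlen, hT, hgen, hcov⟩ := ih
    set K := derivedSeries G k with hKd
    have hK1 : derivedSeries G (k + 1) = ⁅K, K⁆ := derivedSeries_succ G k
    have hK2 : derivedSeries G (k + 1 + 1) = ⁅⁅K, K⁆, ⁅K, K⁆⁆ := by
      rw [derivedSeries_succ, hK1]
    have hKn : K.Normal := derivedSeries_normal G k
    have hTK : T ⊆ K := by
      intro x hx
      rw [← hgen]
      exact Subgroup.mem_sup_left (Subgroup.subset_closure hx)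
    rw [hK1] at hlen hgen hcov
    rw [hK2, hK1]
    let E : Set G := {x | ∃ a ∈ T, ∃ b ∈ T, x = a * b * a⁻¹ * b⁻¹ ∨
      ∃ s ∈ Sig, x = (s * a * s⁻¹) * b * (s * a * s⁻¹)⁻¹ * b⁻¹}
    obtain ⟨L', T', hL', hs', hlen', hT', hgen', hcov'⟩ := layer hS ⁅K, K⁆ ⁅⁅K, K⁆, ⁅K, K⁆⁆
      (Subgroup.commutator_le_left _ _) le_rfl E (by
        rintro x ⟨a, ha, b, hb, rfl | ⟨s, hs, rfl⟩⟩
        · exact Subgroup.commutator_mem_commutator (hTK ha) (hTK hb)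
        · exact Subgroup.commutator_mem_commutator (hKn.conj_mem _ (hTK ha) s) (hTK hb))
      L hL (by
        rintro L' hL' hs' e ⟨a, ha, b, hb, rfl | ⟨s, hs, rfl⟩⟩
        · obtain ⟨L'', h, h'⟩ := Ex.comm hL' (hs' (hT b hb)) (hs' (hT a ha))
          exact ⟨L'', h.mono (by norm_num), h'⟩
        · obtain ⟨L1, h1, h1'⟩ := Ex.conj hL' hs (hs' (hT a ha))
          obtain ⟨L2, h2, h2'⟩ := Ex.comm h1.1 (h1.2.1 (hs' (hT b hb))) h1'
          exact ⟨L2, (h1.trans h2).mono (by norm_num), h2'⟩)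
      (fun U hUn hNU hEU => keyB hS K T hgen U hNU
        (fun a ha b hb => hEU ⟨a, ha, b, hb, Or.inl rfl⟩)
        (fun s hs a ha b hb => hEU ⟨a, ha, b, hb, Or.inr ⟨s, hs, rfl⟩⟩))
    refine ⟨L', T', hL', List.Subset.trans hs hs', by linarith, hT', hgen', ?_⟩
    intro L1 h1 hs1 y0 hy0 u hu
    obtain ⟨L2, h2, hs2, hl2, y, hy, m, hm, e⟩ :=
      hcov L1 h1 (List.Subset.trans hs' hs1) y0 hy0 u hu
    obtain ⟨L3, h3, hs3, hl3, z, hz, p, hp, e3⟩ :=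
      hcov' L2 h2 (List.Subset.trans hs1 hs2) y hy m⁻¹ (Subgroup.inv_mem _ hm)
    refine ⟨L3, h3, List.Subset.trans hs2 hs3, by linarith, z, hz, p, hp, ?_⟩
    rw [e3, e]; group

theorem generated {G : Type*} [Group G] [Finite G] (hsol : Group.IsSolvable G) {Sig : Set G}
    (hS : Subgroup.closure Sig = ⊤) (s0 : G) (hs0 : s0 ∈ Sig) (t : G) :
    ∃ B, St Sig False B ∧ t ∈ B ∧ (B.length : ℝ) ≤ 100 * (Real.logb 2 (Nat.card G) + 1) := by
  have i1 := Ex.gen (I := True) St.nil hs0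
  have i2 := i1.trans (Ex.inv i1.1 (a := s0) (by simp))
  have i3 := i2.trans (Ex.mul i2.1 (a := s0) (b := s0⁻¹) (by simp) (by simp))
  obtain ⟨d, hd⟩ := hsol.solvable
  have hd1 : derivedSeries G (d + 1) = ⊥ := by
    rw [eq_bot_iff, ← hd]; exact derivedSeries_antitone (G := G) (Nat.le_succ d)
  obtain ⟨L, T, hL, hs, hlen, -, -, hcov⟩ := chain hS _ i3.1 d
  have hone : (1 : G) ∈ L := hs (by simp)
  rw [hd1] at hlen hcov
  obtain ⟨L2, h2, hs2, hl2, y, hy, m, hm, e⟩ := hcov L hL (fun _ h => h) 1 hone t trivial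
  rw [Subgroup.mem_bot] at hm
  rw [hm, one_mul, mul_one] at e
  subst e
  obtain ⟨B, hB, hLB, hBl⟩ := elimInv hs0 h2 (Nat.clog 2 (Nat.card G))
    (Nat.le_pow_clog (by norm_num) _)
  refine ⟨B, hB, hLB hy, ?_⟩
  have hb : lg (⊥ : Subgroup G) = 0 := by simp [lg]
  have ht : lg (⊤ : Subgroup G) = Real.logb 2 (Nat.card G) := by simp [lg]
  rw [hb, ht] at hlen hl2
  have hpos : (1 : ℝ) ≤ Nat.card G := by exact_mod_cast Nat.card_pos
  have hlog : 0 ≤ Real.logb 2 (Nat.card G) := Real.logb_nonneg (by norm_num) hpos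
  have hcl : (Nat.clog 2 (Nat.card G) : ℝ) ≤ Real.logb 2 (Nat.card G) + 1 := by
    rcases Nat.lt_or_ge (Nat.card G) 2 with h | h
    · rw [Nat.clog_of_right_le_one (by omega)]; push_cast; linarith
    · have h3 := Nat.pow_pred_clog_lt_self (b := 2) (by norm_num) (x := Nat.card G) (by omega)
      have hp : 0 < Nat.clog 2 (Nat.card G) := Nat.clog_pos (by norm_num) h
      obtain ⟨c, hc⟩ : ∃ c, Nat.clog 2 (Nat.card G) = c + 1 :=
        ⟨_, (Nat.succ_pred_eq_of_pos hp).symm⟩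
      rw [hc, Nat.pred_succ] at h3
      rw [hc]
      have h4 : (c : ℝ) ≤ Real.logb 2 (Nat.card G) := by
        rw [Real.le_logb_iff_rpow_le (by norm_num) (by positivity), Real.rpow_natCast]
        exact_mod_cast h3.le
      push_cast; linarith
  have hB' : (B.length : ℝ) ≤ 3 + 2 * (Nat.clog 2 (Nat.card G)) + 6 * L2.length := by
    exact_mod_cast hBl
  simp only [List.length_cons, List.length_nil] at hlen
  push_cast at hlen
  linarith

theorem St.map {G H : Type*} [Group G] [Group H] (f : H →* G) {Sig : Set H} {Sig' : Set G}
    (hf : ∀ s ∈ Sig, f s ∈ Sig') {I : Prop} {L : List H} (h : St Sig I L) :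
    St Sig' I (L.map f) := by
  induction h with
  | nil => exact St.nil
  | gen x L _ hx ih => exact St.gen _ _ ih (hf x hx)
  | mul a b L _ ha hb ih =>
    rw [List.map_cons, map_mul]
    exact St.mul _ _ _ ih (List.mem_map_of_mem ha) (List.mem_map_of_mem hb)
  | inv a L _ hI ha ih =>
    rw [List.map_cons, map_inv]
    exact St.inv _ _ ih hI (List.mem_map_of_mem ha)

/-- finite solvable groups admit straight-line sequences (multiplications
only) of length `O(log |G|)`. -/
theorem solvable_group_log_straight_line_cost :
    ∃ C : ℝ, 0 < C ∧
      ∀ (G : Type) [Group G] [Fintype G], IsSolvable G →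
        ∀ (Sig : Set G) (t : G), t ∈ Subsemigroup.closure Sig →
          ∃ L : List G, IsSLSeq Sig L ∧ t ∈ L ∧
            (L.length : ℝ) ≤ C * (Real.logb 2 (Fintype.card G) + 1) := by
  refine ⟨100, by norm_num, ?_⟩
  intro G _ _ hsol Sig t ht
  have hne : ∃ s0, s0 ∈ Sig := by
    by_contra hcon
    push Not at hcon
    have : Sig = ∅ := Set.eq_empty_iff_forall_notMem.2 hcon
    rw [this, Subsemigroup.closure_empty] at ht
    exact ht
  obtain ⟨s0, hs0⟩ := hne
  let H := Subgroup.closure Sig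
  have htH : t ∈ H := by
    have : Subsemigroup.closure Sig ≤ H.toSubsemigroup :=
      Subsemigroup.closure_le.2 Subgroup.subset_closure
    exact this ht
  have hsolH : Group.IsSolvable H := by
    have : Group.IsSolvable G := hsol
    infer_instance
  let Sig' : Set H := (fun x : H => (x : G)) ⁻¹' Sig
  have hgen : Subgroup.closure Sig' = ⊤ := Subgroup.closure_closure_coe_preimage
  obtain ⟨B, hB, htB, hlen⟩ := generated (G := H) hsolH hgen
    ⟨s0, Subgroup.subset_closure hs0⟩ hs0 ⟨t, htH⟩
  have hB' : St Sig False (B.map H.subtype) := hB.map H.subtype (fun s hs => hs)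
  refine ⟨(B.map H.subtype).reverse, hB'.toSeq, ?_, ?_⟩
  · rw [List.mem_reverse]
    exact List.mem_map.2 ⟨_, htB, rfl⟩
  · rw [List.length_reverse, List.length_map]
    refine hlen.trans ?_
    have : Real.logb 2 (Nat.card H) ≤ Real.logb 2 (Fintype.card G) := by
      apply Real.logb_le_logb_of_le (by norm_num)
      · exact_mod_cast Nat.card_pos
      · rw [← Nat.card_eq_fintype_card]
        exact_mod_cast Subgroup.card_le_card_group H
    linarith
end

section
/- There exists a constant C > 0 such that for every finite solvable group G, every subset Σ ⊆ G, and every t in the subsemigroup of G generated by Σ, there is a straight-line program over Σ of width 4 and length at most C·(log₂|G| + 1)³ computing t. -/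
namespace SLPAux

abbrev St (G : Type) := Fin 4 → Option G

def Step {G : Type} [Group G] (Sig : Set G) (st st' : St G) : Prop :=
  (∃ k s, s ∈ Sig ∧ st' = Function.update st k (some s)) ∨
  (∃ k i j x y, st i = some x ∧ st j = some y ∧ st' = Function.update st k (some (x * y)))

inductive Run {G : Type} [Group G] (Sig : Set G) : ℕ → St G → St G → Prop
  | refl (a : St G) : Run Sig 0 a a
  | tail {n : ℕ} {a b c : St G} : Run Sig n a b → Step Sig b c → Run Sig (n + 1) a c

section
variable {G : Type} [Group G] {Sig : Set G}

theorem Run.trans {n m : ℕ} {a b c : St G} (h : Run Sig n a b) (h' : Run Sig m b c) :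
    Run Sig (n + m) a c := by
  induction h' with
  | refl => exact h
  | tail _ hs ih => exact Run.tail (ih h) hs

/-- reach within `n` steps -/
def RunLE (Sig : Set G) (n : ℕ) (a b : St G) : Prop := ∃ m ≤ n, Run Sig m a b

theorem RunLE.trans {n m : ℕ} {a b c : St G} (h : RunLE Sig n a b) (h' : RunLE Sig m b c) :
    RunLE Sig (n + m) a c := by
  obtain ⟨x, hx, h⟩ := h
  obtain ⟨y, hy, h'⟩ := h'
  exact ⟨x + y, by omega, h.trans h'⟩

theorem RunLE.refl (a : St G) : RunLE Sig 0 a a := ⟨0, le_rfl, Run.refl a⟩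

theorem RunLE.mono {n m : ℕ} {a b : St G} (h : RunLE Sig n a b) (hnm : n ≤ m) :
    RunLE Sig m a b := by
  obtain ⟨x, hx, h⟩ := h
  exact ⟨x, by omega, h⟩

theorem RunLE.load (a : St G) (k : Fin 4) {s : G} (hs : s ∈ Sig) :
    RunLE Sig 1 a (Function.update a k (some s)) :=
  ⟨1, le_rfl, Run.tail (Run.refl a) (Or.inl ⟨k, s, hs, rfl⟩)⟩

theorem RunLE.mul (a : St G) (k i j : Fin 4) {x y : G} (hi : a i = some x) (hj : a j = some y) :
    RunLE Sig 1 a (Function.update a k (some (x * y))) :=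
  ⟨1, le_rfl, Run.tail (Run.refl a) (Or.inr ⟨k, i, j, x, y, hi, hj, rfl⟩)⟩

/-- Powers: base in register `i`, result in register `j`. -/
theorem run_pow (e : ℕ) : ∀ (he : 2 ≤ e) (a : St G) (i j : Fin 4) (_ : i ≠ j) (x : G)
    (_ : a i = some x),
    RunLE Sig (2 * Nat.log 2 e) a (Function.update a j (some (x ^ e))) := by
  induction e using Nat.strong_induction_on with
  | _ e ih =>
  intro he a i j hij x hx
  have hlog : Nat.log 2 e = Nat.log 2 (e / 2) + 1 := by
    rw [Nat.log_of_one_lt_of_le (by norm_num) he]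
  have key : RunLE Sig (2 * Nat.log 2 (e / 2) + 1) a
      (Function.update a j (some (x ^ (2 * (e / 2))))) := by
    by_cases h4 : 4 ≤ e
    · have h1 := ih (e / 2) (by omega) (by omega) a i j hij x hx
      have h2 := RunLE.mul (Sig := Sig) (Function.update a j (some (x ^ (e / 2)))) j j j
        (Function.update_self ..) (Function.update_self ..)
      have h3 := h1.trans h2
      rwa [Function.update_idem, ← pow_add, ← two_mul] at h3
    · have h1 : e / 2 = 1 := by omega
      have h2 := RunLE.mul (Sig := Sig) a j i i hx hx
      rw [h1]
      simpa [pow_two] using h2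
  rcases Nat.even_or_odd' e with ⟨c, hc | hc⟩
  · have : 2 * (e / 2) = e := by omega
    rw [this] at key
    exact key.mono (by omega)
  · have : 2 * (e / 2) + 1 = e := by omega
    have h2 := RunLE.mul (Sig := Sig) (Function.update a j (some (x ^ (2 * (e / 2))))) j j i
        (Function.update_self ..) (by rw [Function.update_of_ne hij, hx])
    have h3 := key.trans h2
    rw [Function.update_idem, ← pow_succ, this] at h3
    exact h3.mono (by omega)

theorem run_pow' [Finite G] (hG : 2 ≤ Nat.card G) (e : ℕ) (a : St G) (i j : Fin 4) (hij : i ≠ j)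
    (x : G) (hx : a i = some x) :
    RunLE Sig (2 * (Nat.log 2 (Nat.card G) + 1)) a (Function.update a j (some (x ^ e))) := by
  have h := run_pow (Sig := Sig) (e % Nat.card G + Nat.card G) (by omega) a i j hij x hx
  have h1 : x ^ (e % Nat.card G + Nat.card G) = x ^ e := by
    rw [pow_add, pow_card_eq_one', mul_one, pow_mod_natCard]
  rw [h1] at h
  refine h.mono ?_
  have h2 : e % Nat.card G < Nat.card G := Nat.mod_lt _ (by omega)
  have h3 : Nat.log 2 (e % Nat.card G + Nat.card G) ≤ Nat.log 2 (Nat.card G * 2) :=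
    Nat.log_mono_right (by omega)
  rw [Nat.log_mul_base (by norm_num) (by omega)] at h3
  omega

theorem run_inv [Finite G] (hG : 2 ≤ Nat.card G) (a : St G) (i j : Fin 4) (hij : i ≠ j)
    (x : G) (hx : a i = some x) :
    RunLE Sig (2 * (Nat.log 2 (Nat.card G) + 1)) a (Function.update a j (some x⁻¹)) := by
  have h := run_pow' (Sig := Sig) hG (Nat.card G - 1) a i j hij x hx
  have : x ^ (Nat.card G - 1) = x⁻¹ := by
    rw [eq_inv_iff_mul_eq_one, ← pow_succ, Nat.sub_add_cancel (by omega), pow_card_eq_one']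
  rwa [this] at h

/-- products of at most `j` letters -/
def Wd (Sig : Set G) : ℕ → Set G
  | 0 => {1}
  | j + 1 => Wd Sig j ∪ {g | ∃ w ∈ Wd Sig j, ∃ s ∈ Sig, g = w * s}

theorem run_word (n : ℕ) : ∀ w ∈ Wd Sig n, w = 1 ∨ ∀ (a : St G) (i j : Fin 4), i ≠ j →
    ∃ b, RunLE Sig (2 * n) a b ∧ b i = some w ∧ ∀ l, l ≠ i → l ≠ j → b l = a l := by
  induction n with
  | zero => intro w hw; left; simpa [Wd] using hw
  | succ n ih =>
    rintro w (hw | ⟨v, hv, s, hs, rfl⟩)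
    · rcases ih w hw with h | h
      · exact Or.inl h
      · right
        intro a i j hij
        obtain ⟨b, h1, h2⟩ := h a i j hij
        exact ⟨b, h1.mono (by omega), h2⟩
    · right
      intro a i j hij
      rcases ih v hv with h | h
      · subst h
        refine ⟨_, (RunLE.load a i hs).mono (by omega), by simp, ?_⟩
        intro l h1 h2
        simp [h1]
      · obtain ⟨b, h1, h2, h3⟩ := h a i j hij
        have h4 := RunLE.load (Sig := Sig) b j hs
        have h5 := RunLE.mul (Sig := Sig) (Function.update b j (some s)) i i j (x := v) (y := s)
          (by simp [hij, h2]) (by simp)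
        refine ⟨_, ((h1.trans h4).trans h5).mono (by omega), by simp, ?_⟩
        intro l hl1 hl2
        simp [hl1, hl2, h3 l hl1 hl2]

/-- from `x` in `i`, compute `w⁻¹ x w` in `l`, keeping `x` in `i`; `j` is scratch -/
theorem run_conj [Finite G] (hG : 2 ≤ Nat.card G) (n : ℕ) (w : G) (hw : w ∈ Wd Sig n)
    (hw1 : w ≠ 1) (a : St G) (i j l : Fin 4) (hij : i ≠ j) (hil : i ≠ l) (hjl : j ≠ l)
    (x : G) (hx : a i = some x) :
    ∃ b, RunLE Sig (2 * n + 2 * (Nat.log 2 (Nat.card G) + 1) + 2) a b ∧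
      b l = some (w⁻¹ * x * w) ∧ ∀ p, p ≠ j → p ≠ l → b p = a p := by
  rcases run_word n w hw with h | h
  · exact absurd h hw1
  obtain ⟨b, h1, h2, h3⟩ := h a j l hjl
  have h4 := run_inv (Sig := Sig) hG b j l hjl w h2
  have h5 := RunLE.mul (Sig := Sig) (Function.update b l (some w⁻¹)) l l i (x := w⁻¹) (y := x)
    (by simp) (by simp [hil, h3 i hij hil, hx])
  rw [Function.update_idem] at h5
  have h6 := RunLE.mul (Sig := Sig) (Function.update b l (some (w⁻¹ * x))) l l j
    (x := w⁻¹ * x) (y := w) (by simp) (by simp [hjl, h2])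
  rw [Function.update_idem] at h6
  refine ⟨_, (((h1.trans h4).trans h5).trans h6).mono (by omega), by simp, ?_⟩
  intro p hp1 hp2
  simp [hp2, h3 p hp1 hp2]

/-- `x` is computable in `c` steps in any register while preserving one other register -/
def Pr (Sig : Set G) (c : ℕ) (x : G) : Prop :=
  ∀ (a : St G) (k i : Fin 4), i ≠ k → ∃ b, RunLE Sig c a b ∧ b k = a k ∧ b i = some x

theorem others : ∀ k i : Fin 4, i ≠ k → ∃ j l : Fin 4, j ≠ k ∧ l ≠ k ∧ i ≠ j ∧ i ≠ l ∧ j ≠ l := by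
  decide

theorem Pr.comm [Finite G] (hG : 2 ≤ Nat.card G) {c n : ℕ} {x w : G} (hx : Pr Sig c x)
    (hw : w ∈ Wd Sig n) (hw1 : w ≠ 1) :
    Pr Sig (c + (2 * n + 4 * (Nat.log 2 (Nat.card G) + 1) + 5))
      ((w⁻¹ * x * w * x)⁻¹ * (x * (w⁻¹ * x * w))) := by
  intro a k i hik
  obtain ⟨j, l, hj, hl, hij, hil, hjl⟩ := others k i hik
  obtain ⟨b, h1, h2, h3⟩ := hx a k l hl
  obtain ⟨d, h4, h5, h6⟩ := run_conj hG n w hw hw1 b l j i hjl.symm hil.symm hij.symm x h3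
  have hdl : d l = some x := by rw [h6 l hjl.symm hil.symm, h3]
  have hdk : d k = a k := by rw [h6 k hj.symm hik.symm, h2]
  have h7 := RunLE.mul (Sig := Sig) d j l i hdl h5
  have h8 := RunLE.mul (Sig := Sig) (Function.update d j (some (x * (w⁻¹ * x * w)))) l i l
    (x := w⁻¹ * x * w) (y := x) (by simp [hij, h5]) (by simp [hjl.symm, hdl])
  set e := Function.update (Function.update d j (some (x * (w⁻¹ * x * w)))) l
    (some (w⁻¹ * x * w * x)) with he
  have h9 := run_inv (Sig := Sig) hG e l i hil.symm (w⁻¹ * x * w * x) (by simp [he])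
  have h10 := RunLE.mul (Sig := Sig) (Function.update e i (some (w⁻¹ * x * w * x)⁻¹)) i i j
    (x := (w⁻¹ * x * w * x)⁻¹) (y := x * (w⁻¹ * x * w)) (by simp)
    (by simp [he, hij.symm, hjl])
  refine ⟨_, (((((h1.trans h4).trans h7).trans h8).trans h9).trans h10).mono (by omega), ?_, ?_⟩
  · simp [he, hik.symm, hl.symm, hj.symm, hdk]
  · simp

/-- the value in any register can be right-multiplied by `t` in `c` steps -/
def Mu (Sig : Set G) (c : ℕ) (t : G) : Prop :=
  ∀ (a : St G) (k : Fin 4) (g : G), a k = some g → ∃ b, RunLE Sig c a b ∧ b k = some (g * t)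

theorem Mu.one : Mu Sig 0 (1 : G) := fun a _ _ h => ⟨a, RunLE.refl a, by simpa using h⟩

theorem Mu.mul {c d : ℕ} {t u : G} (ht : Mu Sig c t) (hu : Mu Sig d u) :
    Mu Sig (c + d) (t * u) := by
  intro a k g h
  obtain ⟨b, h1, h2⟩ := ht a k g h
  obtain ⟨b', h3, h4⟩ := hu b k _ h2
  exact ⟨b', h1.trans h3, by rw [h4, mul_assoc]⟩

theorem Mu.mono {c d : ℕ} {t : G} (ht : Mu Sig c t) (h : c ≤ d) : Mu Sig d t := by
  intro a k g h'
  obtain ⟨b, h1, h2⟩ := ht a k g h'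
  exact ⟨b, h1.mono h, h2⟩

theorem Pr.mu [Finite G] (hG : 2 ≤ Nat.card G) {c n : ℕ} {x w : G} (hx : Pr Sig c x)
    (hw : w ∈ Wd Sig n) (e : ℕ) :
    Mu Sig (c + (2 * n + 4 * (Nat.log 2 (Nat.card G) + 1) + 3)) ((w⁻¹ * x * w) ^ e) := by
  intro a k g hg
  obtain ⟨i, hik⟩ : ∃ i : Fin 4, i ≠ k := exists_ne k
  obtain ⟨j, l, hj, hl, hij, hil, hjl⟩ := others k i hik
  obtain ⟨b, h1, h2, h3⟩ := hx a k l hl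
  obtain ⟨d, h4, h5, h6⟩ : ∃ d, RunLE Sig (2 * n + 2 * (Nat.log 2 (Nat.card G) + 1) + 2) b d ∧
      (∃ q, q ≠ k ∧ q ≠ j ∧ d q = some (w⁻¹ * x * w)) ∧ d k = some g := by
    by_cases hw1 : w = 1
    · subst hw1
      exact ⟨b, (RunLE.refl b).mono (by omega), ⟨l, hl, hjl.symm, by simpa using h3⟩, by rw [h2, hg]⟩
    · obtain ⟨d, h4, h5, h6⟩ := run_conj hG n w hw hw1 b l j i hjl.symm hil.symm hij.symm x h3
      exact ⟨d, h4, ⟨i, hik, hij, h5⟩, by rw [h6 k hj.symm hik.symm, h2, hg]⟩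
  obtain ⟨q, hqk, hqj, hq⟩ := h5
  have h7 := run_pow' (Sig := Sig) hG e d q j hqj _ hq
  have h8 := RunLE.mul (Sig := Sig) (Function.update d j (some ((w⁻¹ * x * w) ^ e))) k k j
    (x := g) (y := (w⁻¹ * x * w) ^ e) (by simp [hj.symm, h6]) (by simp)
  exact ⟨_, (((h1.trans h4).trans h7).trans h8).mono (by omega), by simp⟩

/-! group theory -/

theorem card_two_mul [Finite G] {A B : Subgroup G} (h : A < B) :
    2 * Nat.card A ≤ Nat.card B := by
  have hd : Nat.card A ∣ Nat.card B := Subgroup.card_dvd_of_le h.le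
  have hne : Nat.card A ≠ Nat.card B := by
    intro he
    exact h.ne (Subgroup.eq_of_le_of_card_ge h.le he.ge)
  obtain ⟨c, hc⟩ := hd
  have hpos : 0 < Nat.card B := Nat.card_pos
  rcases c with _ | _ | c
  · simp at hc; omega
  · simp at hc; omega
  · rw [hc, mul_comm]; exact Nat.mul_le_mul_left _ (by omega)

def Cj (Sig : Set G) (x : G) (n : ℕ) : Set G := {y | ∃ w ∈ Wd Sig n, y = w⁻¹ * x * w}

theorem Wd_mono (n : ℕ) : Wd Sig n ⊆ Wd Sig (n + 1) := fun _ h => Or.inl h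

theorem Cj_mono (x : G) (n : ℕ) : Cj Sig x n ⊆ Cj Sig x (n + 1) := by
  rintro _ ⟨w, hw, rfl⟩
  exact ⟨w, Wd_mono n hw, rfl⟩

theorem one_mem_Wd (n : ℕ) : (1 : G) ∈ Wd Sig n := by
  induction n with
  | zero => rfl
  | succ n ih => exact Or.inl ih

theorem mem_Cj (x : G) (n : ℕ) : x ∈ Cj Sig x n := ⟨1, one_mem_Wd n, by simp⟩

theorem Cj_le (x : G) (n : ℕ) :
    Subgroup.closure (Cj Sig x n) ≤ Subgroup.normalClosure {x} := by
  rw [Subgroup.closure_le]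
  rintro _ ⟨w, -, rfl⟩
  have := (Subgroup.normalClosure_normal (s := {x})).conj_mem x
    (Subgroup.subset_normalClosure rfl) w⁻¹
  simpa using this

theorem closure_stable [Finite G] (hS : Subgroup.closure Sig = ⊤) (x : G) (n : ℕ)
    (h : Subgroup.closure (Cj Sig x (n + 1)) ≤ Subgroup.closure (Cj Sig x n)) :
    Subgroup.closure (Cj Sig x n) = Subgroup.normalClosure {x} := by
  apply le_antisymm (Cj_le x n)
  set K := Subgroup.closure (Cj Sig x n) with hK
  have hs : ∀ s ∈ Sig, ∀ g ∈ K, s⁻¹ * g * s⁻¹⁻¹ ∈ K := by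
    intro s hs g hg
    have : K ≤ K.comap (MulAut.conj s⁻¹).toMonoidHom := by
      rw [hK, Subgroup.closure_le]
      rintro _ ⟨w, hw, rfl⟩
      apply h
      apply Subgroup.subset_closure
      refine ⟨w * s, Or.inr ⟨w, hw, s, hs, rfl⟩, ?_⟩
      simp [mul_assoc]
    exact this hg
  have hn : Subgroup.normalizer (K : Set G) = ⊤ := by
    rw [eq_top_iff, ← hS, Subgroup.closure_le]
    intro s hss
    have := Subgroup.mem_normalizer_fintype (S := (K : Set G)) (x := s⁻¹) (hs s hss)
    simpa using inv_mem this
  have hN : K.Normal := Subgroup.normalizer_eq_top_iff.mp hn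
  exact Subgroup.normalClosure_le_normal (by
    simpa using Subgroup.subset_closure (mem_Cj (Sig := Sig) x n))

theorem closure_Cj [Finite G] (hS : Subgroup.closure Sig = ⊤) (x : G) :
    Subgroup.closure (Cj Sig x (Nat.log 2 (Nat.card G))) = Subgroup.normalClosure {x} := by
  have key : ∀ n, Subgroup.closure (Cj Sig x n) = Subgroup.normalClosure {x} ∨
      2 ^ n ≤ Nat.card (Subgroup.closure (Cj Sig x n)) := by
    intro n
    induction n with
    | zero => right; rw [pow_zero]; exact Nat.card_pos
    | succ n ih =>
      have hle := Subgroup.closure_mono (Cj_mono (Sig := Sig) x n)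
      rcases ih with ih | ih
      · left
        exact le_antisymm (Cj_le x _) (ih ▸ hle)
      · by_cases h : Subgroup.closure (Cj Sig x (n + 1)) ≤ Subgroup.closure (Cj Sig x n)
        · left
          have := closure_stable hS x n h
          exact le_antisymm (Cj_le x _) (this ▸ hle)
        · right
          have := card_two_mul (lt_of_le_not_ge hle h)
          rw [pow_succ]; omega
  by_contra hne
  set m := Nat.log 2 (Nat.card G)
  have h1 := (key m).resolve_left hne
  have h2 : ¬ Subgroup.closure (Cj Sig x (m + 1)) ≤ Subgroup.closure (Cj Sig x m) :=
    fun h => hne (closure_stable hS x m h)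
  have h3 := card_two_mul (lt_of_le_not_ge (Subgroup.closure_mono (Cj_mono (Sig := Sig) x m)) h2)
  have h4 := Subgroup.card_le_card_group (Subgroup.closure (Cj Sig x (m + 1)))
  have h5 : Nat.card G < 2 ^ (m + 1) := Nat.lt_pow_succ_log_self (by norm_num) _
  rw [pow_succ] at h5
  omega

theorem comm_gen {A : Type} [CommGroup A] [Finite A] (T : Set A) (hT : Subgroup.closure T = ⊤)
    (Q : ℕ → A → Prop) (h1 : Q 0 1) (hm : ∀ j t, Q j t → Q (j + 1) t)
    (hs : ∀ j t c (e : ℕ), Q j t → c ∈ T → Q (j + 1) (t * c ^ e)) (t : A) :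
    Q (Nat.log 2 (Nat.card A)) t := by
  have key : ∀ n, (∀ t, Q n t) ∨ ∃ B : Subgroup A, 2 ^ n ≤ Nat.card B ∧ ∀ t ∈ B, Q n t := by
    intro n
    induction n with
    | zero =>
      right
      refine ⟨⊥, by simp, ?_⟩
      intro t ht
      rw [Subgroup.mem_bot] at ht
      exact ht ▸ h1
    | succ n ih =>
      rcases ih with ih | ⟨B, hB, hQ⟩
      · exact Or.inl fun t => hm _ _ (ih t)
      · by_cases hTB : T ⊆ B
        · left
          have : B = ⊤ := by
            rw [eq_top_iff, ← hT, Subgroup.closure_le]; exact hTB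
          intro t
          exact hm _ _ (hQ t (this ▸ Subgroup.mem_top t))
        · right
          obtain ⟨c, hc, hcB⟩ := Set.not_subset.mp hTB
          refine ⟨B ⊔ Subgroup.zpowers c, ?_, ?_⟩
          · have hlt : B < B ⊔ Subgroup.zpowers c := by
              refine lt_of_le_of_ne le_sup_left ?_
              intro h
              apply hcB
              have : c ∈ B ⊔ Subgroup.zpowers c :=
                (le_sup_right : _ ≤ B ⊔ Subgroup.zpowers c) (Subgroup.mem_zpowers c)
              rw [← h] at this
              exact this
            have := card_two_mul hlt
            rw [pow_succ]; omega
          · intro t ht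
            obtain ⟨b, hb, z, hz, rfl⟩ := Subgroup.mem_sup.mp ht
            rw [← mem_powers_iff_mem_zpowers] at hz
            obtain ⟨e, rfl⟩ := hz
            exact hs _ _ _ _ (hQ b hb) hc
  rcases key (Nat.log 2 (Nat.card A)) with h | ⟨B, hB, hQ⟩
  · exact h t
  · have : B = ⊤ := by
      by_contra hne
      have h3 := card_two_mul (lt_top_iff_ne_top.mpr hne)
      rw [Subgroup.card_top] at h3
      have h5 : Nat.card A < 2 ^ (Nat.log 2 (Nat.card A) + 1) :=
        Nat.lt_pow_succ_log_self (by norm_num) _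
      rw [pow_succ] at h5
      omega
    exact hQ t (this ▸ Subgroup.mem_top t)

/-- One step: either the normal closure is abelian or we find a nontrivial commutator. -/
theorem comm_step [Finite G] (hS : Subgroup.closure Sig = ⊤) (x : G)
    (h : ¬ ∀ a ∈ Subgroup.normalClosure {x}, ∀ b ∈ Subgroup.normalClosure {x}, a * b = b * a) :
    ∃ w ∈ Wd Sig (Nat.log 2 (Nat.card G)), x * (w⁻¹ * x * w) ≠ w⁻¹ * x * w * x := by
  by_contra! hc
  apply h
  have h1 : Subgroup.normalClosure {x} ≤ Subgroup.centralizer {x} := by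
    rw [← closure_Cj hS x, Subgroup.closure_le]
    rintro _ ⟨w, hw, rfl⟩
    rw [SetLike.mem_coe, Subgroup.mem_centralizer_singleton_iff]
    first | exact (hc w hw) | exact (hc w hw).symm
  have h2 : Subgroup.normalClosure {x} ≤
      Subgroup.centralizer (Subgroup.normalClosure {x} : Set G) := by
    apply Subgroup.normalClosure_le_normal
    rw [Set.singleton_subset_iff, SetLike.mem_coe, Subgroup.mem_centralizer_iff]
    intro y hy
    have := h1 hy
    rw [Subgroup.mem_centralizer_singleton_iff] at this
    first | exact this | exact this.symm
  intro a ha b hb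
  have := h2 hb
  rw [Subgroup.mem_centralizer_iff] at this
  exact this a ha

theorem exists_abelian [Finite G] [Group.IsSolvable G] (hS : Subgroup.closure Sig = ⊤)
    (hG : 2 ≤ Nat.card G) :
    ∃ x : G, x ≠ 1 ∧ Pr Sig (31 * Nat.log 2 (Nat.card G) ^ 2) x ∧
      ∀ a ∈ Subgroup.normalClosure {x}, ∀ b ∈ Subgroup.normalClosure {x}, a * b = b * a := by
  set m := Nat.log 2 (Nat.card G) with hm
  have hm1 : 1 ≤ m := by
    rw [hm]; exact Nat.log_pos (by norm_num) hG
  by_contra! hcon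
  have key : ∀ j, j ≤ m + 1 → ∃ x : G, x ≠ 1 ∧ Pr Sig (1 + j * (15 * m)) x ∧
      Nat.card (Subgroup.normalClosure {x}) * 2 ^ j ≤ Nat.card G := by
    intro j
    induction j with
    | zero =>
      intro _
      obtain ⟨s, hs, hs1⟩ : ∃ s ∈ Sig, s ≠ 1 := by
        by_contra! hall
        have : Subgroup.closure Sig ≤ ⊥ := by
          rw [Subgroup.closure_le]
          intro s hs
          simpa using hall s hs
        rw [hS] at this
        have h2 := Subgroup.card_le_of_le this
        rw [Subgroup.card_top, Subgroup.card_bot] at h2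
        omega
      refine ⟨s, hs1, ?_, ?_⟩
      · intro a k i hik
        exact ⟨_, (RunLE.load a i hs).mono (by omega), by simp [hik.symm], by simp⟩
      · simpa using Subgroup.card_le_card_group (Subgroup.normalClosure {s})
    | succ j ih =>
      intro hj
      obtain ⟨x, hx1, hx, hcard⟩ := ih (by omega)
      have hna : ¬ ∀ a ∈ Subgroup.normalClosure {x}, ∀ b ∈ Subgroup.normalClosure {x},
          a * b = b * a := by
        intro hab
        have hx' : Pr Sig (31 * m ^ 2) x := by
          intro a k i hik
          obtain ⟨b, h1, h2⟩ := hx a k i hik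
          exact ⟨b, h1.mono (by nlinarith), h2⟩
        obtain ⟨a, ha, b, hb, hne⟩ := hcon x hx1 hx'
        exact hne (hab a ha b hb)
      obtain ⟨w, hw, hne⟩ := comm_step hS x hna
      have hw1 : w ≠ 1 := by
        rintro rfl
        simp at hne
      have hp := Pr.comm hG hx hw hw1
      refine ⟨(w⁻¹ * x * w * x)⁻¹ * (x * (w⁻¹ * x * w)), ?_, ?_, ?_⟩
      rotate_left
      · intro a k i hik
        obtain ⟨b, h1, h2⟩ := hp a k i hik
        exact ⟨b, h1.mono (by rw [← hm]; nlinarith), h2⟩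
      · set N := Subgroup.normalClosure {x} with hN
        have hNn : N.Normal := Subgroup.normalClosure_normal
        have hxN : x ∈ N := Subgroup.subset_normalClosure rfl
        have hyN : w⁻¹ * x * w ∈ N := by simpa using hNn.conj_mem x hxN w⁻¹
        have hNb : N ≠ ⊥ := by
          intro h
          rw [h, Subgroup.mem_bot] at hxN
          exact hx1 hxN
        have hlt : ⁅N, N⁆ < N := Group.IsSolvable.commutator_lt_of_ne_bot hNb
        have hle : Subgroup.normalClosure {(w⁻¹ * x * w * x)⁻¹ * (x * (w⁻¹ * x * w))} ≤ ⁅N, N⁆ := by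
          apply Subgroup.normalClosure_le_normal
          rw [Set.singleton_subset_iff]
          have := Subgroup.commutator_mem_commutator (inv_mem hxN) (inv_mem hyN)
          rw [commutatorElement_def] at this
          simpa [mul_assoc] using this
        have := card_two_mul (lt_of_le_of_lt hle hlt)
        rw [pow_succ]
        calc _ = (2 * Nat.card (Subgroup.normalClosure
                {(w⁻¹ * x * w * x)⁻¹ * (x * (w⁻¹ * x * w))})) * 2 ^ j := by ring
          _ ≤ Nat.card N * 2 ^ j := Nat.mul_le_mul_right _ this
          _ ≤ _ := hcard
      · intro h
        rw [inv_mul_eq_one] at h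
        exact hne h.symm
  obtain ⟨x, -, -, h⟩ := key (m + 1) le_rfl
  have h5 : Nat.card G < 2 ^ (m + 1) := Nat.lt_pow_succ_log_self (by norm_num) _
  have h6 : 0 < Nat.card (Subgroup.normalClosure {x}) := Nat.card_pos
  nlinarith

theorem mu_abelian [Finite G] (hS : Subgroup.closure Sig = ⊤)
    (hG : 2 ≤ Nat.card G) (x : G) (hx : Pr Sig (31 * Nat.log 2 (Nat.card G) ^ 2) x)
    (hab : ∀ a ∈ Subgroup.normalClosure {x}, ∀ b ∈ Subgroup.normalClosure {x}, a * b = b * a)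
    (t : G) (ht : t ∈ Subgroup.normalClosure {x}) :
    Mu Sig (Nat.log 2 (Nat.card (Subgroup.normalClosure {x})) *
      (44 * Nat.log 2 (Nat.card G) ^ 2)) t := by
  set m := Nat.log 2 (Nat.card G) with hm
  have hm1 : 1 ≤ m := by
    rw [hm]; exact Nat.log_pos (by norm_num) hG
  set A := Subgroup.normalClosure {x} with hA
  letI : CommGroup A := { (inferInstance : Group A) with
    mul_comm := fun a b => Subtype.ext (hab a a.2 b b.2) }
  have hAcl : Subgroup.closure (Cj Sig x m) = A := closure_Cj hS x
  have hT : Subgroup.closure (((↑) : A → G) ⁻¹' (Cj Sig x m)) = ⊤ := by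
    have := Subgroup.closure_closure_coe_preimage (k := Cj Sig x m)
    rw [hAcl] at this
    exact this
  have := comm_gen (A := A) (((↑) : A → G) ⁻¹' (Cj Sig x m)) hT
    (fun j t => Mu Sig (j * (44 * m ^ 2)) (t : G)) (by simpa using Mu.one)
    (fun j t h => h.mono (Nat.mul_le_mul_right _ (by omega))) ?_ ⟨t, ht⟩
  · exact this
  · rintro j t ⟨c, hcA⟩ e h ⟨w, hw, hc⟩
    have h1 := h.mul (Pr.mu hG hx hw e)
    have h2 : (t : G) * (w⁻¹ * x * w) ^ e = ((t * (⟨c, hcA⟩ : A) ^ e : A) : G) := by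
      have : c = w⁻¹ * x * w := hc
      subst this
      rfl
    rw [h2] at h1
    refine h1.mono ?_
    rw [← hm]
    nlinarith

end

theorem run_lift {G : Type} [Group G] {Sig : Set G} {H : Type} [Group H] (φ : G →* H)
    {n : ℕ} {a b : St H} (h : Run (φ '' Sig) n a b) (a' : St G)
    (ha : ∀ k, (a' k).map φ = a k) : ∃ b', Run Sig n a' b' ∧ ∀ k, (b' k).map φ = b k := by
  induction h with
  | refl => exact ⟨a', Run.refl _, ha⟩
  | tail _ hs ih =>
    obtain ⟨b', h1, h2⟩ := ih ha
    rcases hs with ⟨k, _, ⟨s, hs, rfl⟩, rfl⟩ | ⟨k, i, j, x, y, hx, hy, rfl⟩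
    · refine ⟨_, Run.tail h1 (Or.inl ⟨k, s, hs, rfl⟩), ?_⟩
      intro l
      by_cases hl : l = k
      · subst hl; simp
      · simp [hl, h2]
    · rw [← h2, Option.map_eq_some_iff] at hx hy
      obtain ⟨x', hx', rfl⟩ := hx
      obtain ⟨y', hy', rfl⟩ := hy
      refine ⟨_, Run.tail h1 (Or.inr ⟨k, i, j, x', y', hx', hy', rfl⟩), ?_⟩
      intro l
      by_cases hl : l = k
      · subst hl; simp
      · simp [hl, h2]

theorem run_push {G : Type} [Group G] {Sig : Set G} {H : Type} [Group H] {Sig' : Set H}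
    (φ : G →* H) (hφ : ∀ s ∈ Sig, φ s ∈ Sig')
    {n : ℕ} {a b : St G} (h : Run Sig n a b) :
    Run Sig' n (fun k => (a k).map φ) (fun k => (b k).map φ) := by
  induction h with
  | refl => exact Run.refl _
  | tail _ hs ih =>
    refine Run.tail ih ?_
    rcases hs with ⟨k, s, hs, rfl⟩ | ⟨k, i, j, x, y, hx, hy, rfl⟩
    · refine Or.inl ⟨k, φ s, hφ s hs, ?_⟩
      funext l
      by_cases hl : l = k
      · subst hl; simp
      · simp [hl]
    · refine Or.inr ⟨k, i, j, φ x, φ y, by simp [hx], by simp [hy], ?_⟩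
      funext l
      by_cases hl : l = k
      · subst hl; simp
      · simp [hl]

theorem main_aux (N : ℕ) : ∀ (G : Type) [Group G] [Finite G] [Group.IsSolvable G] (Sig : Set G),
    Nat.card G = N → Subgroup.closure Sig = ⊤ → Sig.Nonempty → ∀ t : G,
    ∃ b k, RunLE Sig (44 * Nat.log 2 N ^ 3 + 1) (fun _ => none) b ∧ b k = some t := by
  induction N using Nat.strong_induction_on with
  | _ N ih =>
  intro G _ _ _ Sig hN hS hne t
  by_cases hG : 2 ≤ Nat.card G
  · obtain ⟨x, hx1, hx, hab⟩ := exists_abelian hS hG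
    set A := Subgroup.normalClosure {x} with hA
    haveI hAn : A.Normal := Subgroup.normalClosure_normal
    have hA2 : 1 < Nat.card A := by
      rw [Subgroup.one_lt_card_iff_ne_bot]
      intro h
      have : x ∈ A := Subgroup.subset_normalClosure rfl
      rw [h, Subgroup.mem_bot] at this
      exact hx1 this
    have hc : Nat.card G = Nat.card (G ⧸ A) * Nat.card A := Subgroup.card_eq_card_quotient_mul_card_subgroup A
    have hq : 0 < Nat.card (G ⧸ A) := Nat.card_pos
    obtain ⟨b, k, ⟨n, hn, hr⟩, hb⟩ := ih (Nat.card (G ⧸ A)) (by rw [← hN, hc]; nlinarith) (G ⧸ A)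
      (QuotientGroup.mk' A '' Sig) rfl (by
        rw [← MonoidHom.map_closure, hS, ← MonoidHom.range_eq_map, MonoidHom.range_eq_top]
        exact QuotientGroup.mk'_surjective A) (hne.image _) (QuotientGroup.mk' A t)
    obtain ⟨b', h1, h2⟩ := run_lift _ hr (fun _ => none) (by simp)
    have h3 := h2 k
    rw [hb, Option.map_eq_some_iff] at h3
    obtain ⟨u, hu, hut⟩ := h3
    have hm : u⁻¹ * t ∈ A := QuotientGroup.eq.mp hut
    obtain ⟨d, hd, hdk⟩ := mu_abelian hS hG x hx hab _ hm b' k u hu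
    refine ⟨d, k, (RunLE.trans ⟨n, hn, h1⟩ hd).mono ?_, by simpa using hdk⟩
    rw [← hN]
    set m := Nat.log 2 (Nat.card G) with hmdef
    set α := Nat.log 2 (Nat.card A) with hα
    set β := Nat.log 2 (Nat.card (G ⧸ A)) with hβ
    have hsum : β + α ≤ m := by
      rw [hmdef]
      apply Nat.le_log_of_pow_le (by norm_num)
      rw [pow_add, hc]
      exact Nat.mul_le_mul (Nat.pow_log_le_self 2 (by omega)) (Nat.pow_log_le_self 2 (by omega))
    have hβm : β ^ 2 ≤ m ^ 2 := Nat.pow_le_pow_left (by omega) 2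
    have e1 : β * β ^ 2 ≤ β * m ^ 2 := Nat.mul_le_mul_left _ hβm
    have e2 : (β + α) * m ^ 2 ≤ m * m ^ 2 := Nat.mul_le_mul_right _ hsum
    nlinarith
  · have : Subsingleton G := (Finite.card_le_one_iff_subsingleton).mp (by omega)
    obtain ⟨s, hs⟩ := hne
    exact ⟨_, 0, (RunLE.load _ 0 hs).mono (by omega), by simp [Subsingleton.elim s t]⟩

theorem getD_scanl_append {G : Type} [Group G] (P : List (SLPInstr G 4)) (i : SLPInstr G 4)
    (m : ℕ) (hm : m ≤ P.length) (st : St G) (d : St G) :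
    (List.scanl SLPStep st (P ++ [i])).getD m d = (P.take m).foldl SLPStep st := by
  induction P generalizing m st with
  | nil =>
    have : m = 0 := by simpa using hm
    subst this; simp
  | cons p P ihP =>
    cases m with
    | zero => simp
    | succ m =>
      have := ihP m (by simpa using hm) (SLPStep st p)
      simpa using this

theorem getD_scanl {G : Type} [Group G] (P : List (SLPInstr G 4))
    (m : ℕ) (hm : m ≤ P.length) (st : St G) (d : St G) :
    (List.scanl SLPStep st P).getD m d = (P.take m).foldl SLPStep st := by
  induction P generalizing m st with
  | nil =>
    have : m = 0 := by simpa using hm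
    subst this; simp
  | cons p P ihP =>
    cases m with
    | zero => simp
    | succ m =>
      have := ihP m (by simpa using hm) (SLPStep st p)
      simpa using this

/-- validity with states expressed through foldl -/
def OKI {G : Type} (Sig : Set G) (st : St G) : SLPInstr G 4 → Prop
  | SLPInstr.load _ s => s ∈ Sig
  | SLPInstr.mul _ i j => st i ≠ none ∧ st j ≠ none

theorem valid_iff {G : Type} [Group G] (Sig : Set G) (P : List (SLPInstr G 4)) :
    SLPValid Sig P ↔ ∀ m (h : m < P.length),
      OKI Sig ((P.take m).foldl SLPStep (fun _ => none)) P[m] := by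
  unfold SLPValid
  constructor
  · intro H m h
    have := H ⟨m, h⟩
    simp only [SLPStates, List.get_eq_getElem] at this
    rw [getD_scanl P m h.le] at this
    revert this
    cases P[m] <;> exact id
  · rintro H ⟨m, h⟩
    have := H m h
    simp only [SLPStates, List.get_eq_getElem]
    rw [getD_scanl P m h.le]
    revert this
    cases P[m] <;> exact id

theorem run_prog {G : Type} [Group G] {Sig : Set G} {n : ℕ} {a b : St G} (h : Run Sig n a b)
    (ha : a = fun _ => none) :
    ∃ P : List (SLPInstr G 4), P.length = n ∧ SLPValid Sig P ∧
      P.foldl SLPStep (fun _ => none) = b := by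
  induction h with
  | refl => exact ⟨[], rfl, by intro m; exact m.elim0, ha.symm⟩
  | @tail n a b c hr hs ih =>
    obtain ⟨P, hl, hv, hf⟩ := ih ha
    obtain ⟨i, hi, hc⟩ : ∃ i, OKI Sig b i ∧ SLPStep b i = c := by
      rcases hs with ⟨k, s, hs, rfl⟩ | ⟨k, i, j, x, y, hx, hy, rfl⟩
      · exact ⟨.load k s, hs, rfl⟩
      · exact ⟨.mul k i j, ⟨by simp [hx], by simp [hy]⟩, by simp [SLPStep, hx, hy]⟩
    refine ⟨P ++ [i], by simp [hl], ?_, by simp [hf, hc]⟩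
    rw [valid_iff] at hv ⊢
    intro m hm
    by_cases hmP : m < P.length
    · rw [List.getElem_append_left hmP, List.take_append_of_le_length hmP.le]
      exact hv m hmP
    · have : m = P.length := by simp at hm; omega
      subst this
      simpa [hf] using hi

end SLPAux

open SLPAux in
/-- finite solvable groups admit straight-line programs of width 4 and
length `O(log³ |G|)`. -/
theorem solvable_group_width_four_cubed_log_length :
    ∃ C : ℝ, 0 < C ∧
      ∀ (G : Type) [Group G] [Fintype G], IsSolvable G →
        ∀ (Sig : Set G) (t : G), t ∈ Subsemigroup.closure Sig →
          ∃ P : List (SLPInstr G 4), SLPValid Sig P ∧ SLPComputes P t ∧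
            (P.length : ℝ) ≤ C * (Real.logb 2 (Fintype.card G) + 1) ^ 3 := by
  refine ⟨45, by norm_num, ?_⟩
  intro G _ _ hsolv Sig t ht
  have hsolv1 : Group.IsSolvable G := hsolv
  have htH : t ∈ Subgroup.closure Sig := by
    have : Subsemigroup.closure Sig ≤ (Subgroup.closure Sig).toSubmonoid.toSubsemigroup :=
      Subsemigroup.closure_le.mpr Subgroup.subset_closure
    exact this ht
  have hne : Sig.Nonempty := by
    by_contra h
    rw [Set.not_nonempty_iff_eq_empty] at h
    rw [h, Subsemigroup.closure_empty] at ht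
    exact Subsemigroup.notMem_bot ht
  obtain ⟨s0, hs0⟩ := hne
  obtain ⟨b, k, ⟨n, hn, hr⟩, hb⟩ := main_aux _ (Subgroup.closure Sig)
    (((↑) : Subgroup.closure Sig → G) ⁻¹' Sig) rfl
    (Subgroup.closure_closure_coe_preimage (k := Sig))
    ⟨⟨s0, Subgroup.subset_closure hs0⟩, hs0⟩ ⟨t, htH⟩
  have hr' := run_push (Sig' := Sig) (Subgroup.closure Sig).subtype (fun s hs => hs) hr
  obtain ⟨P, hl, hv, hf⟩ := run_prog hr' rfl
  refine ⟨P, hv, ?_, ?_⟩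
  · refine ⟨P.foldl SLPStep (fun _ => none), ?_, k, ?_⟩
    · have h1 := getD_scanl P P.length le_rfl (fun _ => none) (fun _ => none)
      rw [List.take_length] at h1
      rw [← h1, SLPStates, List.getD_eq_getElem _ _ (by simp)]
      exact List.getElem_mem _
    · rw [hf]; simp [hb]
  · rw [hl]
    have hcard : Nat.card (Subgroup.closure Sig) ≤ Fintype.card G := by
      rw [← Nat.card_eq_fintype_card]; exact Subgroup.card_le_card_group _
    have hlog : (Nat.log 2 (Nat.card (Subgroup.closure Sig)) : ℝ) ≤
        Real.logb 2 (Fintype.card G) := by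
      refine le_trans ?_ (Real.natLog_le_logb _ _)
      exact_mod_cast Nat.log_mono_right hcard
    set m := Nat.log 2 (Nat.card (Subgroup.closure Sig))
    have hn' : (n : ℝ) ≤ 44 * (m : ℝ) ^ 3 + 1 := by exact_mod_cast hn
    have hm0 : (0 : ℝ) ≤ m := Nat.cast_nonneg m
    have h1 : (m : ℝ) ^ 3 ≤ (Real.logb 2 (Fintype.card G) + 1) ^ 3 :=
      pow_le_pow_left₀ hm0 (by linarith) 3
    have h2 : (1 : ℝ) ≤ (Real.logb 2 (Fintype.card G) + 1) ^ 3 :=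
      one_le_pow₀ (by linarith)
    linarith
end

section
/- There exists a constant C > 0 with the following property: for every finite normal band of groups S, with partition S = ⋃_{α∈B} S_α indexed by a finite normal band B, in which every group S_α is solvable, for every subset Σ ⊆ S generating S and every t ∈ S, there is a straight-line sequence over Σ of length at most C·(log₂|S| + 1) computing t. -/
/-- Auxiliary: the fiber `π⁻¹(α)` is in multiplicative bijection with the solvable
group `H`. -/
def FiberSolvableAux (S : Type) [Semigroup S] (H : Type) [Group H] {B : Type}
    (π : S → B) (α : B) : Prop :=
  IsSolvable H ∧ ∃ φ : S → H,
    (∀ a b : S, π a = α → π b = α → φ (a * b) = φ a * φ b) ∧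
    (∀ h : H, ∃ s : S, π s = α ∧ φ s = h) ∧
    (∀ a b : S, π a = α → π b = α → φ a = φ b → a = b)

/-- The fiber `π⁻¹(α)` is (as a group) solvable. -/
def FiberSolvable {S B : Type} [Semigroup S] (π : S → B) (α : B) : Prop :=
  ∃ (H : Type) (iH : Group H), @FiberSolvableAux S _ H iH B π α

/-- Abstract straight-line cost calculus: `R k X` means all of `X` can be computed at cost `k`. -/
structure CostRel {S : Type*} [Mul S] (Sig : Set S) (R : ℕ → Set S → Prop) : Prop where
  nil : R 0 ∅
  gen : ∀ k X s, s ∈ Sig → R k X → R (k + 1) (insert s X)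
  mul : ∀ k X x y, x ∈ X → y ∈ X → R k X → R (k + 1) (insert (x * y) X)
  mono : ∀ k k' X X', k ≤ k' → X' ⊆ X → R k X → R k' X'

/-- The concrete cost relation. -/
def SLReach {S : Type*} [Semigroup S] (Sig : Set S) (k : ℕ) (X : Set S) : Prop :=
  ∃ L : List S, IsSLSeq Sig L ∧ (∀ x ∈ X, x ∈ L) ∧ L.length ≤ k

lemma isSLSeq_append {S : Type*} [Semigroup S] {Sig : Set S} {L : List S} (hL : IsSLSeq Sig L)
    (z : S) (hz : z ∈ Sig ∨ ∃ x ∈ L, ∃ y ∈ L, z = x * y) : IsSLSeq Sig (L ++ [z]) := by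
  rintro ⟨m, hm⟩
  simp only [List.length_append, List.length_singleton] at hm
  by_cases hmL : m < L.length
  · rcases hL ⟨m, hmL⟩ with h | ⟨i, j, hi, hj, h⟩
    · left; simpa [List.getElem_append_left hmL] using h
    · right
      refine ⟨⟨i, by simp⟩, ⟨j, by simp⟩, hi, hj, ?_⟩
      simpa [List.getElem_append_left hmL] using h
  · have : m = L.length := by omega
    subst this
    rcases hz with h | ⟨x, hx, y, hy, h⟩
    · left; simpa using h
    · right
      obtain ⟨i, hi, rfl⟩ := List.getElem_of_mem hx
      obtain ⟨j, hj, rfl⟩ := List.getElem_of_mem hy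
      refine ⟨⟨i, by simp; omega⟩, ⟨j, by simp; omega⟩, hi, hj, ?_⟩
      simpa [List.getElem_append_left hi, List.getElem_append_left hj] using h

lemma slReach_costRel {S : Type*} [Semigroup S] (Sig : Set S) : CostRel Sig (SLReach Sig) where
  nil := ⟨[], by rintro ⟨m, hm⟩; simp at hm, by simp, by simp⟩
  gen := by
    rintro k X s hs ⟨L, hL, hX, hk⟩
    refine ⟨L ++ [s], isSLSeq_append hL s (Or.inl hs), ?_, by simpa using hk⟩
    rintro x (rfl | hx)
    · simp
    · simp [hX x hx]
  mul := by
    rintro k X s t hs ht ⟨L, hL, hX, hk⟩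
    refine ⟨L ++ [s * t], isSLSeq_append hL _ (Or.inr ⟨s, hX s hs, t, hX t ht, rfl⟩), ?_,
      by simpa using hk⟩
    rintro x (rfl | hx)
    · simp
    · simp [hX x hx]
  mono := by
    rintro k k' X X' hk hX ⟨L, hL, h, hk'⟩
    exact ⟨L, hL, fun x hx => h x (hX hx), hk'.trans hk⟩

/-- Fast exponentiation. -/
lemma CostRel.pow_aux {S : Type*} [Mul S] {Sig : Set S} {R : ℕ → Set S → Prop}
    (hR : CostRel Sig R) (f : ℕ → S) (hf : ∀ a b, 1 ≤ a → 1 ≤ b → f (a + b) = f a * f b)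
    (X : Set S) (h1 : f 1 ∈ X) (k : ℕ) (hk : R k X) :
    ∀ m a : ℕ, 1 ≤ a → a < 2 ^ m → R (k + 2 * m) (insert (f a) X) := by
  intro m
  induction m with
  | zero => intro a h1 h2; simp at h2; omega
  | succ m ih =>
    intro a ha1 ha2
    rcases Nat.lt_or_ge a 2 with h | h
    · have : a = 1 := by omega
      subst this
      exact hR.mono _ _ _ _ (by omega) (by rw [Set.insert_eq_of_mem h1]) hk
    · have hq := ih (a / 2) (by omega) (by rw [pow_succ] at ha2; omega)
      have h2 := hR.mul _ _ (f (a / 2)) (f (a / 2)) (by simp) (by simp) hq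
      rw [← hf _ _ (by omega) (by omega)] at h2
      rcases Nat.mod_two_eq_zero_or_one a with h0 | h0
      · refine hR.mono _ _ _ _ (by omega) ?_ h2
        have : a / 2 + a / 2 = a := by omega
        rw [this]
        exact Set.insert_subset_insert (Set.subset_insert _ _)
      · have h3 := hR.mul _ _ (f (a / 2 + a / 2)) (f 1) (by simp) (by simp [h1]) h2
        rw [← hf _ _ (by omega) (by omega)] at h3
        refine hR.mono _ _ _ _ (by omega) ?_ h3
        have : a / 2 + a / 2 + 1 = a := by omega
        rw [this]
        exact Set.insert_subset_insert ((Set.subset_insert _ _).trans (Set.subset_insert _ _))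

lemma CostRel.pow {S : Type*} [Monoid S] {Sig : Set S} {R : ℕ → Set S → Prop}
    (hR : CostRel Sig R) {x : S} {X : Set S} (h1 : x ∈ X) (h0 : 1 ∈ X) {k : ℕ} (hk : R k X)
    (m a : ℕ) (ha : a < 2 ^ m) : R (k + 2 * m) (insert (x ^ a) X) := by
  rcases Nat.eq_zero_or_pos a with rfl | h
  · refine hR.mono _ _ _ _ (by omega) ?_ hk
    rw [pow_zero, Set.insert_eq_of_mem h0]
  · exact hR.pow_aux (fun a => x ^ a) (fun a b _ _ => pow_add x a b) X (by simpa using h1) k hk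
      m a h ha

lemma card_double {G : Type*} [Group G] [Finite G] {K K' : Subgroup G} (h : K < K') :
    2 * Nat.card K ≤ Nat.card K' := by
  have hd := Subgroup.card_dvd_of_le h.le
  obtain ⟨c, hc⟩ := hd
  have hlt : Nat.card K < Nat.card K' := by
    by_contra hcon
    exact h.ne (Subgroup.eq_of_le_of_card_ge h.le (not_lt.1 hcon))
  have : 2 ≤ c := by
    by_contra hcc
    have : c = 0 ∨ c = 1 := by omega
    rcases this with rfl | rfl <;> omega
  rw [hc, mul_comm]
  exact Nat.mul_le_mul_left _ this

/-- Choose few generators. -/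
lemma exists_gen_list {G : Type*} [Group G] [Finite G] (Sig : Set G)
    (hS : Subgroup.closure Sig = ⊤) :
    ∃ l : List G, (∀ x ∈ l, x ∈ Sig) ∧ Subgroup.closure {x | x ∈ l} = ⊤ ∧
      2 ^ l.length ≤ Nat.card G := by
  have key : ∀ n : ℕ, ∀ l : List G, (∀ x ∈ l, x ∈ Sig) →
      2 ^ l.length ≤ Nat.card (Subgroup.closure {x | x ∈ l}) →
      Nat.card G - Nat.card (Subgroup.closure {x | x ∈ l}) ≤ n →
      ∃ l : List G, (∀ x ∈ l, x ∈ Sig) ∧ Subgroup.closure {x | x ∈ l} = ⊤ ∧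
        2 ^ l.length ≤ Nat.card G := by
    intro n
    induction n with
    | zero =>
      intro l h1 h2 h3
      have hle := Subgroup.card_le_card_group (Subgroup.closure {x | x ∈ l})
      exact ⟨l, h1, Subgroup.eq_top_of_card_eq _ (by omega), h2.trans hle⟩
    | succ n ih =>
      intro l h1 h2 h3
      by_cases htop : Subgroup.closure {x | x ∈ l} = ⊤
      · exact ⟨l, h1, htop, h2.trans (Subgroup.card_le_card_group _)⟩
      · have : ∃ g ∈ Sig, g ∉ Subgroup.closure {x | x ∈ l} := by
          by_contra hcon
          push Not at hcon
          apply htop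
          rw [eq_top_iff, ← hS, Subgroup.closure_le]
          exact hcon
        obtain ⟨g, hg, hgn⟩ := this
        have hlt : Subgroup.closure {x | x ∈ l} < Subgroup.closure {x | x ∈ g :: l} := by
          refine lt_of_le_of_ne (Subgroup.closure_mono fun x hx => ?_) ?_
          · simp only [Set.mem_ofPred_eq] at hx ⊢; simp [hx]
          · intro heq
            apply hgn
            rw [heq]
            exact Subgroup.subset_closure (by simp)
        have hd := card_double hlt
        have hp : 0 < Nat.card (Subgroup.closure {x | x ∈ l}) := Nat.card_pos
        refine ih (g :: l) ?_ ?_ ?_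
        · intro x hx
          rcases List.mem_cons.1 hx with rfl | hx
          · exact hg
          · exact h1 x hx
        · simp only [List.length_cons, pow_succ]; omega
        · omega
  refine key _ [] (by simp) ?_ le_rfl
  simp

section GroupPart

variable {G : Type*} [Group G] {Sig : Set G} {R : ℕ → Set G → Prop}

/-- Compute all the list members and initial products. -/
lemma CostRel.partialProducts (hR : CostRel Sig R) (h1 : (1 : G) ∈ Sig) (l : List G)
    (hl : ∀ x ∈ l, x ∈ Sig) :
    ∃ X : Set G, (∀ x ∈ l, x ∈ X) ∧ (∀ l', l' <+: l → l'.prod ∈ X) ∧ R (1 + 2 * l.length) X := by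
  induction l using List.reverseRecOn with
  | nil =>
    refine ⟨insert 1 ∅, by simp, ?_, by simpa using hR.gen _ _ _ h1 hR.nil⟩
    intro l' hl'
    rw [List.prefix_nil] at hl'
    simp [hl']
  | append_singleton l g ih =>
    obtain ⟨X, hX1, hX2, hX⟩ := ih (fun x hx => hl x (by simp [hx]))
    have h2 := hR.gen _ _ g (hl g (by simp)) hX
    have h3 := hR.mul _ _ l.prod g (by simp [hX2 l (List.prefix_refl l)]) (by simp) h2
    refine ⟨_, ?_, ?_, hR.mono _ _ _ _ ?_ le_rfl h3⟩
    · intro x hx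
      rcases List.mem_append.1 hx with hx | hx
      · simp [hX1 x hx]
      · simp at hx; simp [hx]
    · intro l' hl'
      rcases List.prefix_concat_iff.1 (by simpa using hl') with h | h
      · subst h; simp
      · simp [hX2 l' h]
    · simp; omega

lemma CostRel.inverses (hR : CostRel Sig R) (l : List G) : ∀ (X : Set G) (k : ℕ),
    (∀ x ∈ l, x ∈ X) → (∀ l', l' <+: l → l'.prod ∈ X) → l.prod⁻¹ ∈ X → R k X →
    ∃ X', X ⊆ X' ∧ (∀ x ∈ l, x⁻¹ ∈ X') ∧ R (k + 2 * l.length) X' := by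
  induction l using List.reverseRecOn with
  | nil => intro X k _ _ _ hk; exact ⟨X, le_rfl, by simp, by simpa using hk⟩
  | append_singleton l g ih =>
    intro X k h1 h2 h3 hk
    have s1 := hR.mul _ _ (l ++ [g]).prod⁻¹ l.prod h3 (h2 l (List.prefix_append _ _)) hk
    have s2 := hR.mul _ _ g (l ++ [g]).prod⁻¹ (by simp [h1 g (by simp)])
      (Set.mem_insert_of_mem _ h3) s1
    have e1 : (l ++ [g]).prod⁻¹ * l.prod = g⁻¹ := by simp
    have e2 : g * (l ++ [g]).prod⁻¹ = l.prod⁻¹ := by simp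
    rw [e2, e1] at s2
    obtain ⟨X', hX', h4, h5⟩ := ih _ _ (fun x hx => by simp [h1 x (by simp [hx])])
      (fun l' hl' => by simp [h2 l' (hl'.trans (List.prefix_append _ _))]) (by simp) s2
    refine ⟨X', fun x hx => hX' (by simp [hx]), ?_, hR.mono _ _ _ _ (by simp; omega) le_rfl h5⟩
    intro x hx
    rcases List.mem_append.1 hx with hx | hx
    · exact h4 x hx
    · simp at hx; subst hx; exact hX' (by simp)

/-- Initial stage: a small symmetric generating set. -/
lemma CostRel.initial [Finite G] (hR : CostRel Sig R) (h1 : (1 : G) ∈ Sig)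
    (hS : Subgroup.closure Sig = ⊤) :
    ∃ X : Set G, (1 : G) ∈ X ∧ (∀ x ∈ X, x⁻¹ ∈ X) ∧ Subgroup.closure X = ⊤ ∧
      R (6 * Nat.log 2 (Nat.card G) + 3) X := by
  obtain ⟨l, hl, hc, hcard⟩ := exists_gen_list Sig hS
  obtain ⟨X, hX1, hX2, hX⟩ := hR.partialProducts h1 l hl
  have hone : (1 : G) ∈ X := by simpa using hX2 [] (by simp)
  have hp := hR.pow (hX2 l (List.prefix_refl l)) hone hX (Nat.log 2 (Nat.card G) + 1)
    (orderOf l.prod - 1) (by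
      have := Nat.lt_pow_succ_log_self (b := 2) (by norm_num) (Nat.card G)
      have h2 := orderOf_le_card (x := l.prod)
      simp only [Nat.succ_eq_add_one] at this
      omega)
  have hinv : l.prod ^ (orderOf l.prod - 1) = l.prod⁻¹ := by
    rw [eq_inv_iff_mul_eq_one, ← pow_succ, Nat.sub_add_cancel (orderOf_pos _), pow_orderOf_eq_one]
  rw [hinv] at hp
  obtain ⟨X', hX', h4, h5⟩ := hR.inverses l _ _ (fun x hx => by simp [hX1 x hx])
    (fun l' hl' => by simp [hX2 l' hl']) (by simp) hp
  refine ⟨{x | x = 1 ∨ x ∈ l ∨ x⁻¹ ∈ l}, by simp, ?_, ?_, hR.mono _ _ _ _ ?_ ?_ h5⟩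
  · rintro x (rfl | h | h)
    · simp
    · simp [h]
    · simp [h]
  · rw [eq_top_iff, ← hc]
    exact Subgroup.closure_mono fun x hx => Or.inr (Or.inl hx)
  · have := Nat.le_log_of_pow_le (by norm_num) hcard
    omega
  · rintro x (rfl | h | h)
    · exact hX' (by simp [hone])
    · exact hX' (by simp [hX1 x h])
    · simpa using h4 _ h

end GroupPart

section Layers

open scoped commutatorElement

variable {G : Type*} [Group G]

lemma comm_mem_of_gen (M : Subgroup G) [M.Normal] (S : Set G)
    (h : ∀ x ∈ S, ∀ y ∈ S, ⁅x, y⁆ ∈ M) (a b : G) (ha : a ∈ Subgroup.closure S ⊔ M)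
    (hb : b ∈ Subgroup.closure S ⊔ M) : ⁅a, b⁆ ∈ M := by
  let f := QuotientGroup.mk' M
  have hle : Subgroup.closure S ⊔ M ≤ (Subgroup.closure (f '' S)).comap f := by
    refine sup_le ?_ ?_
    · rw [Subgroup.closure_le]
      intro x hx
      exact Subgroup.subset_closure ⟨x, hx, rfl⟩
    · intro x hx
      have : f x = 1 := (QuotientGroup.eq_one_iff x).2 hx
      rw [Subgroup.mem_comap, this]
      exact one_mem _
  have hcomm : ∀ x ∈ f '' S, ∀ y ∈ f '' S, x * y = y * x := by
    rintro _ ⟨x, hx, rfl⟩ _ ⟨y, hy, rfl⟩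
    have : f ⁅x, y⁆ = 1 := (QuotientGroup.eq_one_iff _).2 (h x hx y hy)
    rw [map_commutatorElement, commutatorElement_eq_one_iff_mul_comm] at this
    exact this
  have h1 : Subgroup.closure (f '' S) ≤ Subgroup.centralizer (f '' S) := by
    rw [Subgroup.closure_le]
    intro x hx
    rw [SetLike.mem_coe, Subgroup.mem_centralizer_iff]
    intro y hy
    exact hcomm y hy x hx
  have h2 : Subgroup.closure (f '' S) ≤
      Subgroup.centralizer (Subgroup.closure (f '' S) : Set (G ⧸ M)) := by
    rw [Subgroup.closure_le]
    intro x hx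
    rw [SetLike.mem_coe, Subgroup.mem_centralizer_iff]
    intro y hy
    exact (Subgroup.mem_centralizer_iff.1 (h1 hy) x hx).symm
  have h3 := Subgroup.mem_centralizer_iff.1 (h2 (hle ha)) _ (hle hb)
  have h4 : f ⁅a, b⁆ = 1 := by
    rw [map_commutatorElement, commutatorElement_eq_one_iff_mul_comm]
    exact h3.symm
  exact (QuotientGroup.eq_one_iff _).1 h4

/-- A normal subgroup covering the abelianization of `D_i` contains `D_i` (solvable case). -/
lemma le_of_le_sup_succ [Group.IsSolvable G] (K : Subgroup G) [K.Normal] (i : ℕ)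
    (h : derivedSeries G i ≤ K ⊔ derivedSeries G (i + 1)) : derivedSeries G i ≤ K := by
  have key : ∀ m, derivedSeries G i ≤ K ⊔ derivedSeries G (i + 1 + m) := by
    intro m
    induction m with
    | zero => exact h
    | succ m ih =>
      have := derivedSeries_normal G (i + 1 + m + 1)
      refine h.trans (sup_le le_sup_left ?_)
      rw [derivedSeries_succ, Subgroup.commutator_le]
      intro a ha b hb
      have hc : ∀ x ∈ (derivedSeries G (i + 1 + m) : Set G),
          ∀ y ∈ (derivedSeries G (i + 1 + m) : Set G),
          ⁅x, y⁆ ∈ K ⊔ derivedSeries G (i + 1 + m + 1) := by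
        intro x hx y hy
        apply Subgroup.mem_sup_right
        rw [derivedSeries_succ]
        exact Subgroup.commutator_mem_commutator hx hy
      have hle : K ⊔ derivedSeries G (i + 1 + m) ≤
          Subgroup.closure (derivedSeries G (i + 1 + m) : Set G) ⊔
            (K ⊔ derivedSeries G (i + 1 + m + 1)) := by
        rw [Subgroup.closure_eq]
        exact sup_le (le_sup_left.trans le_sup_right) le_sup_left
      exact comm_mem_of_gen _ _ hc a b (hle (ih ha)) (hle (ih hb))
  obtain ⟨n, hn⟩ := Group.IsSolvable.solvable (G := G)
  have hb : derivedSeries G (i + 1 + n) = ⊥ := by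
    rw [eq_bot_iff, ← hn]
    exact derivedSeries_antitone G (by omega)
  have := key n
  rwa [hb, sup_bot_eq] at this

/-- Criterion for `K` to be everything. -/
lemma layer_full [Group.IsSolvable G] (X : Set G) (K : Subgroup G) [K.Normal] (i : ℕ)
    (hX : Subgroup.closure (X ∩ derivedSeries G i) ⊔ derivedSeries G (i + 2) = derivedSeries G i)
    (hc : ∀ x ∈ X ∩ derivedSeries G i, ∀ y ∈ X ∩ derivedSeries G i, ⁅x, y⁆ ∈ K) :
    derivedSeries G (i + 1) ≤ K := by
  apply le_of_le_sup_succ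
  have := derivedSeries_normal G (i + 1 + 1)
  rw [derivedSeries_succ, Subgroup.commutator_le]
  intro a ha b hb
  have hle : derivedSeries G i ≤ Subgroup.closure (X ∩ derivedSeries G i) ⊔
      (K ⊔ derivedSeries G (i + 1 + 1)) := by
    conv_lhs => rw [← hX]
    exact sup_le le_sup_left (le_sup_right.trans le_sup_right)
  exact comm_mem_of_gen _ _ (fun x hx y hy => Subgroup.mem_sup_left (hc x hx y hy)) a b
    (hle ha) (hle hb)

lemma normal_of_gen [Finite G] (X : Set G) (hX : Subgroup.closure X = ⊤) (K : Subgroup G)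
    (h : ∀ g ∈ X, ∀ k ∈ K, g * k * g⁻¹ ∈ K) : K.Normal := by
  constructor
  intro n hn g
  have hmap : ∀ g ∈ X, K.map (MulAut.conj g).toMonoidHom = K := by
    intro g hg
    refine Subgroup.eq_of_le_of_card_ge ?_ ?_
    · rintro _ ⟨k, hk, rfl⟩
      simpa using h g hg k hk
    · exact (Nat.card_congr (K.equivMapOfInjective _ (MulAut.conj g).injective).toEquiv).le
  have hg : g ∈ Subgroup.closure X := by rw [hX]; trivial
  revert n
  induction hg using Subgroup.closure_induction'' with
  | mem x hx => intro n hn; exact h x hx n hn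
  | inv_mem x hx =>
    intro n hn
    rw [← hmap x hx] at hn
    obtain ⟨k, hk, rfl⟩ := hn
    simpa [mul_assoc] using hk
  | one => intro n hn; simpa using hn
  | mul x y _ _ hx hy =>
    intro n hn
    have := hx _ (hy n hn)
    simpa [mul_assoc] using this

variable {Sig : Set G} {R : ℕ → Set G → Prop}

lemma CostRel.conj (hR : CostRel Sig R) {X : Set G} {k : ℕ} (hX : R k X)
    (hsym : ∀ x ∈ X, x⁻¹ ∈ X) {g x : G} (hg : g ∈ X) (hx : x ∈ X) :
    R (k + 6) (insert (g * x * g⁻¹) (insert (g * x * g⁻¹)⁻¹ X)) := by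
  have hg' := hsym g hg
  have hx' := hsym x hx
  have s1 := hR.mul _ _ g x hg hx hX
  have s2 := hR.mul _ _ (g * x) g⁻¹ (by simp) (by simp [hg']) s1
  have s3 := hR.mul _ _ g x⁻¹ (by simp [hg]) (by simp [hx']) s2
  have s4 := hR.mul _ _ (g * x⁻¹) g⁻¹ (by simp) (by simp [hg']) s3
  refine hR.mono _ _ _ _ (by omega) ?_ s4
  intro z hz
  simp only [Set.mem_insert_iff] at hz ⊢
  rcases hz with h | h | h
  · simp [h]
  · left; rw [h]; group
  · simp [h]

lemma CostRel.comm (hR : CostRel Sig R) {X : Set G} {k : ℕ} (hX : R k X)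
    (hsym : ∀ x ∈ X, x⁻¹ ∈ X) {x y : G} (hx : x ∈ X) (hy : y ∈ X) :
    R (k + 6) (insert ⁅x, y⁆ (insert ⁅x, y⁆⁻¹ X)) := by
  have hx' := hsym x hx
  have hy' := hsym y hy
  have s1 := hR.mul _ _ x y hx hy hX
  have s2 := hR.mul _ _ (x * y) x⁻¹ (by simp) (by simp [hx']) s1
  have s3 := hR.mul _ _ (x * y * x⁻¹) y⁻¹ (by simp) (by simp [hy']) s2
  have s4 := hR.mul _ _ y x (by simp [hy]) (by simp [hx]) s3
  have s5 := hR.mul _ _ (y * x) y⁻¹ (by simp) (by simp [hy']) s4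
  have s6 := hR.mul _ _ (y * x * y⁻¹) x⁻¹ (by simp) (by simp [hx']) s5
  refine hR.mono _ _ _ _ (by omega) ?_ s6
  intro z hz
  simp only [Set.mem_insert_iff] at hz ⊢
  rcases hz with h | h | h
  · rw [h, commutatorElement_def]; simp
  · rw [h, commutatorElement_inv, commutatorElement_def]; simp
  · simp [h]

/-- Greedy construction of one more layer. -/
lemma CostRel.layer [Finite G] [Group.IsSolvable G] (hR : CostRel Sig R) (i : ℕ) :
    ∀ (n : ℕ) (X : Set G) (k : ℕ), R k X → (∀ x ∈ X, x⁻¹ ∈ X) → Subgroup.closure X = ⊤ →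
    Subgroup.closure (X ∩ derivedSeries G i) ⊔ derivedSeries G (i + 2) = derivedSeries G i →
    Nat.card (derivedSeries G (i + 1)) - Nat.card
      (Subgroup.closure (X ∩ derivedSeries G (i + 1)) ⊔ derivedSeries G (i + 3) : Subgroup G) ≤ n →
    ∃ (X' : Set G) (r : ℕ), X ⊆ X' ∧ R (k + 6 * r) X' ∧ (∀ x ∈ X', x⁻¹ ∈ X') ∧
      Subgroup.closure (X' ∩ derivedSeries G (i + 1)) ⊔ derivedSeries G (i + 3)
        = derivedSeries G (i + 1) ∧
      2 ^ r * Nat.card (Subgroup.closure (X ∩ derivedSeries G (i + 1)) ⊔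
        derivedSeries G (i + 3) : Subgroup G) ≤ Nat.card (derivedSeries G (i + 1)) := by
  intro n
  induction n with
  | zero =>
    intro X k hX hsym htop hprev hn
    have hle : Subgroup.closure (X ∩ derivedSeries G (i + 1)) ⊔ derivedSeries G (i + 3) ≤
        derivedSeries G (i + 1) := by
      refine sup_le ?_ (derivedSeries_antitone G (by omega))
      rw [Subgroup.closure_le]
      exact Set.inter_subset_right
    have heq := Subgroup.eq_of_le_of_card_ge hle (by omega)
    exact ⟨X, 0, le_rfl, by simpa using hX, hsym, heq, by rw [heq]; simp⟩
  | succ n ih =>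
    intro X k hX hsym htop hprev hn
    have hle : ∀ X : Set G, Subgroup.closure (X ∩ derivedSeries G (i + 1)) ⊔
        derivedSeries G (i + 3) ≤ derivedSeries G (i + 1) := by
      intro X
      refine sup_le ?_ (derivedSeries_antitone G (by omega))
      rw [Subgroup.closure_le]
      exact Set.inter_subset_right
    by_cases heq : Subgroup.closure (X ∩ derivedSeries G (i + 1)) ⊔ derivedSeries G (i + 3)
        = derivedSeries G (i + 1)
    · exact ⟨X, 0, le_rfl, by simpa using hX, hsym, heq, by rw [heq]; simp⟩
    · have hex : ∃ c ∈ derivedSeries G (i + 1),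
          c ∉ Subgroup.closure (X ∩ derivedSeries G (i + 1)) ⊔ derivedSeries G (i + 3) ∧
          R (k + 6) (insert c (insert c⁻¹ X)) := by
        by_contra hcon
        push Not at hcon
        apply heq
        refine le_antisymm (hle X) ?_
        have hN3 := derivedSeries_normal G (i + 3)
        have hN1 := derivedSeries_normal G (i + 1)
        have : (Subgroup.closure (X ∩ derivedSeries G (i + 1)) ⊔
            derivedSeries G (i + 3)).Normal := by
          refine normal_of_gen X htop _ ?_
          intro g hg x hx
          have : Subgroup.closure (X ∩ derivedSeries G (i + 1)) ⊔ derivedSeries G (i + 3) ≤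
              (Subgroup.closure (X ∩ derivedSeries G (i + 1)) ⊔ derivedSeries G (i + 3)).comap
                (MulAut.conj g).toMonoidHom := by
            refine sup_le ?_ ?_
            · rw [Subgroup.closure_le]
              rintro y ⟨hy, hy1⟩
              by_contra hyn
              exact hcon (g * y * g⁻¹) (hN1.conj_mem _ hy1 _) (by simpa using hyn)
                (hR.conj hX hsym hg hy)
            · intro y hy
              exact Subgroup.mem_sup_right (by simpa using hN3.conj_mem _ hy g)
          simpa using this hx
        refine layer_full X _ i hprev ?_
        rintro x ⟨hx, hx1⟩ y ⟨hy, hy1⟩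
        by_contra hyn
        refine hcon ⁅x, y⁆ ?_ hyn (hR.comm hX hsym hx hy)
        rw [derivedSeries_succ]
        exact Subgroup.commutator_mem_commutator hx1 hy1
      obtain ⟨c, hc1, hc2, hc3⟩ := hex
      have hsub : X ⊆ insert c (insert c⁻¹ X) :=
        (Set.subset_insert _ _).trans (Set.subset_insert _ _)
      have hlt : Subgroup.closure (X ∩ derivedSeries G (i + 1)) ⊔ derivedSeries G (i + 3) <
          Subgroup.closure ((insert c (insert c⁻¹ X)) ∩ derivedSeries G (i + 1)) ⊔
            derivedSeries G (i + 3) := by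
        refine lt_of_le_of_ne (sup_le_sup_right (Subgroup.closure_mono
          (Set.inter_subset_inter_left _ hsub)) _) ?_
        intro h
        apply hc2
        rw [h]
        exact Subgroup.mem_sup_left (Subgroup.subset_closure ⟨by simp, hc1⟩)
      have hd := card_double hlt
      have hp : 0 < Nat.card (Subgroup.closure (X ∩ derivedSeries G (i + 1)) ⊔
        derivedSeries G (i + 3) : Subgroup G) := Nat.card_pos
      have a1 : ∀ x ∈ insert c (insert c⁻¹ X), x⁻¹ ∈ insert c (insert c⁻¹ X) := by
        rintro x (rfl | rfl | hx)
        · simp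
        · simp
        · simp [hsym x hx]
      have a2 : Subgroup.closure (insert c (insert c⁻¹ X)) = ⊤ := by
        rw [eq_top_iff, ← htop]
        exact Subgroup.closure_mono hsub
      have a3 : Subgroup.closure (insert c (insert c⁻¹ X) ∩ derivedSeries G i) ⊔
          derivedSeries G (i + 2) = derivedSeries G i := by
        refine le_antisymm (sup_le ?_ (derivedSeries_antitone G (by omega))) ?_
        · rw [Subgroup.closure_le]
          exact Set.inter_subset_right
        · conv_lhs => rw [← hprev]
          exact sup_le_sup_right (Subgroup.closure_mono (Set.inter_subset_inter_left _ hsub)) _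
      obtain ⟨X', r, h1, h2, h3, h4, h5⟩ :=
        ih (insert c (insert c⁻¹ X)) (k + 6) hc3 a1 a2 a3 (by omega)
      refine ⟨X', r + 1, hsub.trans h1, hR.mono _ _ _ _ (by omega) le_rfl h2, h3, h4, ?_⟩
      refine le_trans ?_ h5
      rw [pow_succ, mul_assoc]
      exact Nat.mul_le_mul_left _ hd

lemma CostRel.all_layers [Finite G] [Group.IsSolvable G] (hR : CostRel Sig R) (X : Set G)
    (k : ℕ) (hX : R k X) (hsym : ∀ x ∈ X, x⁻¹ ∈ X)
    (htop : Subgroup.closure X = ⊤) (i : ℕ) :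
    ∃ (X' : Set G) (r : ℕ), X ⊆ X' ∧ R (k + 6 * r) X' ∧ (∀ x ∈ X', x⁻¹ ∈ X') ∧
      (∀ j ≤ i, Subgroup.closure (X' ∩ derivedSeries G j) ⊔ derivedSeries G (j + 2)
        = derivedSeries G j) ∧
      2 ^ r * (Nat.card (derivedSeries G (i + 1)) * Nat.card (derivedSeries G (i + 2)))
        ≤ Nat.card G * Nat.card G := by
  induction i with
  | zero =>
    refine ⟨X, 0, le_rfl, by simpa using hX, hsym, ?_, ?_⟩
    · intro j hj
      obtain rfl : j = 0 := by omega
      rw [derivedSeries_zero, Subgroup.coe_top, Set.inter_univ, htop, top_sup_eq]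
    · rw [pow_zero, one_mul]
      exact Nat.mul_le_mul (Subgroup.card_le_card_group _) (Subgroup.card_le_card_group _)
  | succ i ih =>
    obtain ⟨X₁, r, h2, h3, h4, h5, h6⟩ := ih
    obtain ⟨X₂, r', g1, g2, g3, g4, g5⟩ := hR.layer i _ X₁ (k + 6 * r) h3 h4
      (by rw [eq_top_iff, ← htop]; exact Subgroup.closure_mono h2) (h5 i le_rfl) le_rfl
    refine ⟨X₂, r + r', h2.trans g1, hR.mono _ _ _ _ (by omega) le_rfl g2, g3, ?_, ?_⟩
    · intro j hj
      rcases Nat.lt_or_ge i j with h | h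
      · obtain rfl : j = i + 1 := by omega
        exact g4
      · refine le_antisymm (sup_le ?_ (derivedSeries_antitone G (by omega))) ?_
        · rw [Subgroup.closure_le]
          exact Set.inter_subset_right
        · conv_lhs => rw [← h5 j h]
          exact sup_le_sup_right (Subgroup.closure_mono (Set.inter_subset_inter_left _ g1)) _
    · refine le_trans ?_ h6
      have hc : Nat.card (derivedSeries G (i + 3)) ≤ Nat.card
          (Subgroup.closure (X₁ ∩ derivedSeries G (i + 1)) ⊔ derivedSeries G (i + 3) :
            Subgroup G) := Subgroup.card_le_of_le le_sup_right
      have hc2 := (Nat.mul_le_mul_left (2 ^ r') hc).trans g5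
      calc 2 ^ (r + r') * (Nat.card (derivedSeries G (i + 1 + 1)) *
            Nat.card (derivedSeries G (i + 1 + 2)))
          = 2 ^ r * ((2 ^ r' * Nat.card (derivedSeries G (i + 3))) *
            Nat.card (derivedSeries G (i + 2))) := by rw [pow_add]; ring
        _ ≤ 2 ^ r * (Nat.card (derivedSeries G (i + 1)) * Nat.card (derivedSeries G (i + 2))) :=
          Nat.mul_le_mul_left _ (Nat.mul_le_mul_right _ hc2)

end Layers

section Final

open scoped commutatorElement

variable {G : Type*} [Group G]

/-- The subgroup `H⟨x⟩` when `x` normalizes `H`. -/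
def extSubgroup (H : Subgroup G) (x : G) (hx : ∀ h ∈ H, ∀ a : ℤ, x ^ a * h * x ^ (-a) ∈ H) :
    Subgroup G where
  carrier := {g | ∃ h ∈ H, ∃ a : ℤ, g = h * x ^ a}
  mul_mem' := by
    rintro _ _ ⟨h, hh, a, rfl⟩ ⟨h', hh', b, rfl⟩
    refine ⟨h * (x ^ a * h' * x ^ (-a)), mul_mem hh (hx h' hh' a), a + b, ?_⟩
    rw [zpow_add]; group
  one_mem' := ⟨1, one_mem _, 0, by simp⟩
  inv_mem' := by
    rintro _ ⟨h, hh, a, rfl⟩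
    refine ⟨x ^ (-a) * h⁻¹ * x ^ (- -a), hx _ (inv_mem hh) (-a), -a, ?_⟩
    group

lemma mem_extSubgroup {H : Subgroup G} {x : G}
    {hx : ∀ h ∈ H, ∀ a : ℤ, x ^ a * h * x ^ (-a) ∈ H} {g : G} :
    g ∈ extSubgroup H x hx ↔ ∃ h ∈ H, ∃ a : ℤ, g = h * x ^ a := Iff.rfl

variable {Sig : Set G} {R : ℕ → Set G → Prop}

lemma CostRel.extend [Finite G] (hR : CostRel Sig R) {X : Set G} {k : ℕ}
    (h1 : (1 : G) ∈ X) (H : Subgroup G)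
    (hH : ∀ h ∈ H, R (k + 5 * Nat.log 2 (Nat.card H)) (insert h X))
    (x : G) (hxX : x ∈ X) (hxH : x ∉ H)
    (hx : ∀ h ∈ H, ∀ a : ℤ, x ^ a * h * x ^ (-a) ∈ H) :
    ∀ h ∈ extSubgroup H x hx,
      R (k + 5 * Nat.log 2 (Nat.card (extSubgroup H x hx))) (insert h X) := by
  classical
  have hex : ∃ n : ℕ, 0 < n ∧ x ^ n ∈ H :=
    ⟨orderOf x, orderOf_pos x, by rw [pow_orderOf_eq_one]; exact one_mem _⟩
  obtain ⟨n, ⟨hn0, hnH⟩, hmin⟩ : ∃ n : ℕ, (0 < n ∧ x ^ n ∈ H) ∧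
      ∀ m < n, ¬ (0 < m ∧ x ^ m ∈ H) :=
    ⟨Nat.find hex, Nat.find_spec hex, fun m hm => Nat.find_min hex hm⟩
  have hn2 : 2 ≤ n := by
    by_contra hcon
    obtain rfl : n = 1 := by omega
    exact hxH (by simpa using hnH)
  have hcard : Nat.card H * n ≤ Nat.card (extSubgroup H x hx) := by
    have hinj : Function.Injective (fun p : H × Fin n =>
        (⟨p.1 * x ^ (p.2 : ℕ), p.1, p.1.2, (p.2 : ℕ), by simp⟩ : extSubgroup H x hx)) := by
      have aux : ∀ (h h' : H) (a b : Fin n), (a : ℕ) < b →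
          (h : G) * x ^ (a : ℕ) ≠ h' * x ^ (b : ℕ) := by
        intro h h' a b hab heq
        refine hmin (b - a : ℕ) (by omega) ⟨by omega, ?_⟩
        have hb : (b : ℕ) = (b - a : ℕ) + a := by omega
        rw [hb, pow_add, ← mul_assoc] at heq
        have h2 := mul_right_cancel heq
        have : x ^ ((b : ℕ) - a) = (h' : G)⁻¹ * h := by rw [h2]; group
        rw [this]
        exact mul_mem (inv_mem h'.2) h.2
      rintro ⟨h, a⟩ ⟨h', b⟩ heq
      have heq' : (h : G) * x ^ (a : ℕ) = h' * x ^ (b : ℕ) := congrArg Subtype.val heq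
      rcases lt_trichotomy (a : ℕ) b with hab | hab | hab
      · exact absurd heq' (aux h h' a b hab)
      · have : a = b := Fin.ext hab
        subst this
        have := mul_right_cancel heq'
        rw [Subtype.ext this]
      · exact absurd heq'.symm (aux h' h b a hab)
    have := Nat.card_le_card_of_injective _ hinj
    rwa [Nat.card_prod, Nat.card_fin] at this
  have hlog : Nat.log 2 (Nat.card H) + Nat.log 2 n ≤
      Nat.log 2 (Nat.card (extSubgroup H x hx)) := by
    apply Nat.le_log_of_pow_le (by norm_num)
    refine le_trans ?_ hcard
    rw [pow_add]
    exact Nat.mul_le_mul (Nat.pow_log_le_self 2 Nat.card_pos.ne')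
      (Nat.pow_log_le_self 2 (by omega))
  have hlogn : 1 ≤ Nat.log 2 n := Nat.le_log_of_pow_le (by norm_num) (by simpa using hn2)
  rintro g ⟨h, hh, a, rfl⟩
  obtain ⟨h', hh', b, hb, heq⟩ : ∃ h' ∈ H, ∃ b < n, h * x ^ a = h' * x ^ b := by
    have hnz : (n : ℤ) ≠ 0 := by omega
    have hpos := Int.emod_nonneg a hnz
    have hlt := Int.emod_lt_of_pos a (by omega : (0 : ℤ) < n)
    refine ⟨h * (x ^ n) ^ (a / n), mul_mem hh (Subgroup.zpow_mem _ hnH _), (a % n).toNat,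
      by omega, ?_⟩
    have e1 : x ^ (a % n).toNat = x ^ (a % n) := by
      rw [← zpow_natCast, Int.toNat_of_nonneg hpos]
    rw [e1, mul_assoc, ← zpow_natCast x n, ← zpow_mul, ← zpow_add, Int.mul_ediv_add_emod]
  rw [heq]
  have s1 := hH h' hh'
  have s2 := hR.pow (x := x) (by simp [hxX]) (by simp [h1]) s1 (Nat.log 2 n + 1) b
    (hb.trans (Nat.lt_pow_succ_log_self (by norm_num) n))
  have s3 := hR.mul _ _ h' (x ^ b) (by simp) (by simp) s2
  refine hR.mono _ _ _ _ (by omega) ?_ s3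
  exact Set.insert_subset_insert ((Set.subset_insert _ _).trans (Set.subset_insert _ _))

lemma CostRel.final_layer [Finite G] (hR : CostRel Sig R) {X : Set G} {k : ℕ}
    (h1 : (1 : G) ∈ X) (j : ℕ)
    (hj : Subgroup.closure (X ∩ derivedSeries G j) ⊔ derivedSeries G (j + 2)
        = derivedSeries G j) :
    ∀ (m : ℕ) (H : Subgroup G), derivedSeries G (j + 1) ≤ H → H ≤ derivedSeries G j →
      (∀ h ∈ H, R (k + 5 * Nat.log 2 (Nat.card H)) (insert h X)) →
      Nat.card (derivedSeries G j) - Nat.card H ≤ m →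
      ∀ h ∈ derivedSeries G j,
        R (k + 5 * Nat.log 2 (Nat.card (derivedSeries G j))) (insert h X) := by
  intro m
  induction m with
  | zero =>
    intro H hle1 hle2 hH hm
    rw [← Subgroup.eq_of_le_of_card_ge hle2 (by omega)]
    exact hH
  | succ m ih =>
    intro H hle1 hle2 hH hm
    by_cases heq : H = derivedSeries G j
    · rw [← heq]; exact hH
    · obtain ⟨x, hxX, hxD, hxH⟩ : ∃ x ∈ X, x ∈ derivedSeries G j ∧ x ∉ H := by
        by_contra hcon
        push Not at hcon
        apply heq
        refine le_antisymm hle2 ?_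
        rw [← hj]
        refine sup_le ?_ ((derivedSeries_antitone G (by omega)).trans hle1)
        rw [Subgroup.closure_le]
        rintro x ⟨hx, hx'⟩
        exact hcon x hx hx'
      have hconj : ∀ h ∈ H, ∀ a : ℤ, x ^ a * h * x ^ (-a) ∈ H := by
        intro h hh a
        have : x ^ a * h * x ^ (-a) = ⁅x ^ a, h⁆ * h := by
          rw [commutatorElement_def]; group
        rw [this]
        refine mul_mem (hle1 ?_) hh
        rw [derivedSeries_succ]
        exact Subgroup.commutator_mem_commutator (Subgroup.zpow_mem _ hxD _) (hle2 hh)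
      have hHle : H ≤ extSubgroup H x hconj := fun h hh => ⟨h, hh, 0, by simp⟩
      have hlt : H < extSubgroup H x hconj := by
        refine lt_of_le_of_ne hHle ?_
        intro h
        apply hxH
        rw [h]
        exact ⟨1, one_mem _, 1, by simp⟩
      have hd := card_double hlt
      have hp : 0 < Nat.card H := Nat.card_pos
      refine ih (extSubgroup H x hconj) (hle1.trans hHle) ?_
        (hR.extend h1 H hH x hxX hxH hconj) (by omega)
      rintro _ ⟨h, hh, a, rfl⟩
      exact mul_mem (hle2 hh) (Subgroup.zpow_mem _ hxD _)

/-- The theorem for finite solvable groups. -/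
theorem CostRel.solvable_group [Finite G] [Group.IsSolvable G] (hR : CostRel Sig R)
    (h1 : (1 : G) ∈ Sig) (hS : Subgroup.closure Sig = ⊤) (t : G) :
    R (23 * Nat.log 2 (Nat.card G) + 9) {t} := by
  obtain ⟨X, hX1, hXs, hXt, hX⟩ := hR.initial h1 hS
  obtain ⟨d, hd⟩ := Group.IsSolvable.solvable (G := G)
  obtain ⟨X', r, hXX', hX', -, hlay, hr⟩ := hR.all_layers X _ hX hXs hXt d
  have hr' : r ≤ 2 * Nat.log 2 (Nat.card G) + 1 := by
    have hp1 : 0 < Nat.card (derivedSeries G (d + 1)) := Nat.card_pos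
    have hp2 : 0 < Nat.card (derivedSeries G (d + 2)) := Nat.card_pos
    have h2 : 2 ^ r ≤ Nat.card G * Nat.card G :=
      (Nat.le_mul_of_pos_right _ (Nat.mul_pos hp1 hp2)).trans hr
    have h3 := Nat.lt_pow_succ_log_self (b := 2) (by norm_num) (Nat.card G)
    have h4 : 2 ^ r < 2 ^ (2 * (Nat.log 2 (Nat.card G) + 1)) := by
      refine lt_of_le_of_lt h2 ?_
      rw [two_mul, pow_add]
      exact Nat.mul_lt_mul'' h3 h3
    have := (Nat.pow_lt_pow_iff_right (by norm_num)).1 h4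
    omega
  have hone := hXX' hX1
  have key : ∀ m ≤ d, ∀ h ∈ derivedSeries G (d - m),
      R (6 * Nat.log 2 (Nat.card G) + 3 + 6 * r +
        5 * Nat.log 2 (Nat.card (derivedSeries G (d - m)))) (insert h X') := by
    intro m
    induction m with
    | zero =>
      intro _ h hh
      rw [Nat.sub_zero, hd, Subgroup.mem_bot] at hh
      subst hh
      refine hR.mono _ _ _ _ (by omega) ?_ hX'
      rw [Set.insert_eq_of_mem hone]
    | succ m ih =>
      intro hm
      have e : d - (m + 1) + 1 = d - m := by omega
      refine hR.final_layer hone _ (hlay _ (by omega)) _ (derivedSeries G (d - m)) ?_ ?_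
        (ih (by omega)) le_rfl
      · rw [e]
      · exact derivedSeries_antitone G (by omega)
  have := key d le_rfl t (by rw [Nat.sub_self, derivedSeries_zero]; trivial)
  rw [Nat.sub_self, derivedSeries_zero, Subgroup.card_top] at this
  exact hR.mono _ _ _ _ (by omega) (by simp) this

end Final

section Bands

lemma semilattice_absorb {M : Type*} [CommMonoid M] [DecidableEq M] (idem : ∀ x : M, x * x = x)
    (J K : Finset M) (h : J ⊆ K) : (∏ x ∈ J, x) * ∏ x ∈ K, x = ∏ x ∈ K, x := by
  rw [← Finset.prod_sdiff h, mul_left_comm, idem]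

lemma semilattice_small {M : Type*} [CommMonoid M] [Finite M] (idem : ∀ x : M, x * x = x)
    (F : Finset M) : ∃ F' ⊆ F, ∏ x ∈ F', x = ∏ x ∈ F, x ∧ 2 ^ F'.card ≤ Nat.card M := by
  classical
  induction F using Finset.strongInduction with
  | H F ih =>
    by_cases hred : ∃ i ∈ F, ∏ x ∈ F.erase i, x = ∏ x ∈ F, x
    · obtain ⟨i, hi, h⟩ := hred
      obtain ⟨F', h1, h2, h3⟩ := ih (F.erase i) (Finset.erase_ssubset hi)
      exact ⟨F', h1.trans (Finset.erase_subset _ _), h2.trans h, h3⟩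
    · push Not at hred
      refine ⟨F, le_rfl, rfl, ?_⟩
      have key : ∀ I ⊆ F, ∀ J ⊆ F, ∏ x ∈ I, x = ∏ x ∈ J, x → I ⊆ J := by
        intro I hI J hJ heq i hi
        by_contra hij
        apply hred i (hI hi)
        have h1 : J ⊆ F.erase i := fun x hx =>
          Finset.mem_erase.2 ⟨fun h => hij (h ▸ hx), hJ hx⟩
        rw [← semilattice_absorb idem J _ h1, ← heq, ← Finset.mul_prod_erase I _ hi, mul_assoc,
          semilattice_absorb idem _ _ (Finset.erase_subset_erase i hI)]
        exact Finset.mul_prod_erase F (fun x => x) (hI hi)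
      have hinj : Function.Injective (fun I : F.powerset => ∏ x ∈ I.1, x) := by
        rintro ⟨I, hI⟩ ⟨J, hJ⟩ h
        rw [Finset.mem_powerset] at hI hJ
        exact Subtype.ext (le_antisymm (key I hI J hJ h) (key J hJ I hI h.symm))
      have := Nat.card_le_card_of_injective _ hinj
      rwa [Nat.card_eq_fintype_card, Fintype.card_coe, Finset.card_powerset] at this

variable {B : Type*} [Semigroup B]

/-- The local semilattice `aBb` of a normal band. -/
abbrev localMonoid (idem : ∀ b : B, b * b = b)
    (nrm : ∀ a x y b : B, a * x * y * b = a * y * x * b) (a b : B) :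
    CommMonoid {x : B // a * x = x ∧ x * b = x} where
  mul x y := ⟨x.1 * y.1, by rw [← mul_assoc, x.2.1], by rw [mul_assoc, y.2.2]⟩
  mul_assoc x y z := Subtype.ext (mul_assoc _ _ _)
  one := ⟨a * b, by rw [← mul_assoc, idem], by rw [mul_assoc, idem]⟩
  one_mul x := Subtype.ext (by
    change a * b * x.1 = x.1
    calc a * b * x.1 = a * b * x.1 * b := by rw [mul_assoc (a * b), x.2.2]
      _ = a * x.1 * b * b := nrm _ _ _ _
      _ = x.1 := by rw [x.2.1, x.2.2, x.2.2])
  mul_one x := Subtype.ext (by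
    change x.1 * (a * b) = x.1
    calc x.1 * (a * b) = a * x.1 * a * b := by rw [x.2.1, mul_assoc]
      _ = a * a * x.1 * b := nrm _ _ _ _
      _ = x.1 := by rw [idem, x.2.1, x.2.2])
  mul_comm x y := Subtype.ext (by
    change x.1 * y.1 = y.1 * x.1
    calc x.1 * y.1 = a * x.1 * y.1 * b := by rw [x.2.1, mul_assoc, y.2.2]
      _ = a * y.1 * x.1 * b := nrm _ _ _ _
      _ = y.1 * x.1 := by rw [y.2.1, mul_assoc, x.2.2])

lemma band_left (idem : ∀ b : B, b * b = b)
    (nrm : ∀ a x y b : B, a * x * y * b = a * y * x * b) {α x y : B}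
    (h : α * (x * y) * α = α) : α * x * α = α := by
  calc α * x * α = α * x * (α * (x * y) * α) := by rw [h]
    _ = α * x * α * (x * y * α) := by simp only [mul_assoc]
    _ = α * α * x * (x * y * α) := nrm _ _ _ _
    _ = α * α * (x * x) * y * α := by simp only [mul_assoc]
    _ = α := by rw [idem, idem, mul_assoc α x y, h]

lemma band_mul (idem : ∀ b : B, b * b = b)
    (nrm : ∀ a x y b : B, a * x * y * b = a * y * x * b) {α x y : B}
    (hx : α * x * α = α) (hy : α * y * α = α) : α * (x * y) * α = α := by
  calc α * (x * y) * α = α * α * x * (y * α) := by rw [idem]; simp only [mul_assoc]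
    _ = α * x * α * (y * α) := nrm _ _ _ _
    _ = α := by rw [hx, ← mul_assoc, hy]

lemma band_right (idem : ∀ b : B, b * b = b)
    (nrm : ∀ a x y b : B, a * x * y * b = a * y * x * b) {α x y : B}
    (h : α * (x * y) * α = α) : α * y * α = α := by
  have hx := band_left idem nrm h
  calc α * y * α = α * x * α * (y * α) := by rw [hx, mul_assoc]
    _ = α * α * x * (y * α) := nrm _ _ _ _
    _ = α * (x * y) * α := by rw [idem]; simp only [mul_assoc]
    _ = α := h

lemma band_absorb (idem : ∀ b : B, b * b = b)
    (nrm : ∀ a x y b : B, a * x * y * b = a * y * x * b) {α y c : B}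
    (hy : α * y * α = α) : α * (y * c) = α * c := by
  calc α * (y * c) = α * α * y * c := by rw [idem, mul_assoc]
    _ = α * y * α * c := nrm _ _ _ _
    _ = α * c := by rw [hy]

/-- Reaching the right component of the band cheaply. -/
lemma band_reach {S : Type*} [Semigroup S] [Finite B] [Finite S] (π : S →ₙ* B)
    (idem : ∀ b : B, b * b = b)
    (nrm : ∀ a x y b : B, a * x * y * b = a * y * x * b) (Sig : Set S)
    (hS : Subsemigroup.closure Sig = ⊤) (t : S) :
    ∃ w, π w = π t ∧ SLReach Sig (2 * Nat.log 2 (Nat.card B) + 3) {w} := by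
  classical
  have hR := slReach_costRel Sig
  have hends : ∀ x : S, (∃ s ∈ Sig, π s * π x = π x) ∧ (∃ s ∈ Sig, π x * π s = π x) := by
    intro x
    have hx : x ∈ Subsemigroup.closure Sig := by rw [hS]; trivial
    induction hx using Subsemigroup.closure_induction with
    | mem x hx => exact ⟨⟨x, hx, idem _⟩, ⟨x, hx, idem _⟩⟩
    | mul x y _ _ hx hy =>
      obtain ⟨⟨s, hs, h⟩, -⟩ := hx
      obtain ⟨-, ⟨s', hs', h'⟩⟩ := hy
      refine ⟨⟨s, hs, ?_⟩, ⟨s', hs', ?_⟩⟩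
      · rw [map_mul, ← mul_assoc, h]
      · rw [map_mul, mul_assoc, h']
  obtain ⟨⟨sa, hsa, ha⟩, ⟨sb, hsb, hb⟩⟩ := hends t
  set α := π t with hα
  set a := π sa with haa
  set b := π sb with hbb
  let _ := localMonoid idem nrm a b
  have hmul : ∀ x y : {x : B // a * x = x ∧ x * b = x}, (x * y).1 = x.1 * y.1 := fun _ _ => rfl
  have hone : (1 : {x : B // a * x = x ∧ x * b = x}).1 = a * b := rfl
  have midem : ∀ x : {x : B // a * x = x ∧ x * b = x}, x * x = x :=
    fun x => Subtype.ext (idem _)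
  let g : B → {x : B // a * x = x ∧ x * b = x} := fun x =>
    ⟨a * x * b, by rw [mul_assoc, ← mul_assoc a, idem], by rw [mul_assoc, idem]⟩
  have hmid : ∀ c y : B, a * c = c → c * b * (a * y * b) = c * y * b := by
    intro c y hc
    calc c * b * (a * y * b) = a * c * (b * a) * (y * b) := by rw [hc]; simp only [mul_assoc]
      _ = a * (b * a) * c * (y * b) := nrm _ _ _ _
      _ = a * b * (a * c * y) * b := by simp only [mul_assoc]
      _ = a * (a * c * y) * b * b := nrm _ _ _ _
      _ = c * y * b := by
        rw [hc, ← mul_assoc, hc, mul_assoc (c * y), idem]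
  have gmul : ∀ x y : B, g (x * y) = g x * g y := by
    intro x y
    apply Subtype.ext
    change a * (x * y) * b = a * x * b * (a * y * b)
    rw [hmid (a * x) y (by rw [← mul_assoc, idem])]
    simp only [mul_assoc]
  let αM : {x : B // a * x = x ∧ x * b = x} := ⟨α, ha, hb⟩
  have gα : g α = αM := Subtype.ext (by change a * α * b = α; rw [ha, hb])
  let F : Finset {x : B // a * x = x ∧ x * b = x} :=
    (Set.toFinite {m | ∃ s ∈ Sig, α * π s * α = α ∧ m = g (π s)}).toFinset
  have hF : ∀ m, m ∈ F ↔ ∃ s ∈ Sig, α * π s * α = α ∧ m = g (π s) := by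
    intro m; simp [F]
  have habs : ∀ m ∈ F, m * αM = αM := by
    intro m hm
    obtain ⟨s, hs, h, rfl⟩ := (hF m).1 hm
    have : αM * g (π s) * αM = αM := by
      have h2 : g (α * π s * α) = αM := by rw [h, gα]
      rwa [gmul, gmul, gα] at h2
    rwa [mul_comm αM, mul_assoc, midem] at this
  have hprod1 : ∀ F' : Finset {x : B // a * x = x ∧ x * b = x}, F' ⊆ F →
      (∏ x ∈ F', x) * αM = αM := by
    intro F'
    induction F' using Finset.induction_on with
    | empty => intro _; simp
    | insert m F' hm ih =>
      intro h
      rw [Finset.prod_insert hm, mul_assoc, ih ((Finset.subset_insert _ _).trans h),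
        habs m (h (by simp))]
  have hprod2 : ∀ x : S, α * π x * α = α → (∏ x ∈ F, x) * g (π x) = ∏ x ∈ F, x := by
    intro x
    have hx : x ∈ Subsemigroup.closure Sig := by rw [hS]; trivial
    induction hx using Subsemigroup.closure_induction with
    | mem x hx =>
      intro h
      have hm : g (π x) ∈ F := (hF _).2 ⟨x, hx, h, rfl⟩
      rw [← Finset.mul_prod_erase F _ hm, mul_right_comm, midem]
    | mul x y _ _ hx hy =>
      intro h
      rw [map_mul] at h
      rw [map_mul, gmul, ← mul_assoc, hx (band_left idem nrm h), hy (band_right idem nrm h)]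
  have hpF : ∏ x ∈ F, x = αM := by
    have h1 := hprod1 F le_rfl
    have h2 := hprod2 t (by rw [← hα, idem, idem])
    rw [← hα, gα] at h2
    exact h2.symm.trans h1
  obtain ⟨F', hF', hFp, hFc⟩ := semilattice_small midem F
  have hlist : ∀ l : List {x : B // a * x = x ∧ x * b = x}, (∀ m ∈ l, m ∈ F) →
      ∃ w, a * π w = π w ∧ π w * b = l.prod.1 ∧ SLReach Sig (2 * l.length + 1) {w} := by
    intro l
    induction l with
    | nil =>
      intro _
      refine ⟨sa, idem _, rfl, ?_⟩
      exact hR.mono _ _ _ _ (by simp) (by simp) (hR.gen _ _ _ hsa hR.nil)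
    | cons m l ih =>
      intro h
      obtain ⟨w, hw1, hw2, hw3⟩ := ih (fun m hm => h m (by simp [hm]))
      obtain ⟨s, hs, -, rfl⟩ := (hF m).1 (h m (by simp))
      refine ⟨w * s, ?_, ?_, ?_⟩
      · rw [map_mul, ← mul_assoc, hw1]
      · rw [List.prod_cons, mul_comm, hmul, ← hw2, map_mul]
        exact (hmid _ _ hw1).symm
      · have s1 := hR.gen _ _ _ hs hw3
        have s2 := hR.mul _ _ w s (by simp) (by simp) s1
        exact hR.mono _ _ _ _ (by simp; omega) (by simp) s2
  obtain ⟨w, hw1, hw2, hw3⟩ := hlist F'.toList (fun m hm => hF' (by simpa using hm))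
  refine ⟨w * sb, ?_, ?_⟩
  · rw [map_mul, ← hbb, hw2]
    have : F'.toList.prod = αM := by
      rw [← hpF, ← hFp, ← Finset.prod_map_toList]
      simp
    rw [this]
  · have s1 := hR.gen _ _ _ hsb hw3
    have s2 := hR.mul _ _ w sb (by simp) (by simp) s1
    refine hR.mono _ _ _ _ ?_ (by simp) s2
    have h1 : Nat.card {x : B // a * x = x ∧ x * b = x} ≤ Nat.card B :=
      Nat.card_le_card_of_injective _ Subtype.val_injective
    have := Nat.le_log_of_pow_le (by norm_num) (hFc.trans h1)
    rw [Finset.length_toList]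
    omega

end Bands

/-- The main bound, in natural numbers. -/
theorem normal_band_nat_bound (S B : Type) [Semigroup S] [Fintype S] [Semigroup B] [Fintype B]
    (π : S →ₙ* B) (e : B → S) (hsurj : Function.Surjective π)
    (idem : ∀ b : B, b * b = b)
    (nrm : ∀ a x y b : B, a * x * y * b = a * y * x * b)
    (hπe : ∀ α : B, π (e α) = α)
    (hid : ∀ s : S, e (π s) * s = s ∧ s * e (π s) = s)
    (hinv : ∀ s : S, ∃ s' : S, π s' = π s ∧ s * s' = e (π s) ∧ s' * s = e (π s))
    (hsol : ∀ α : B, FiberSolvable (⇑π) α)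
    (Sig : Set S) (hS : Subsemigroup.closure Sig = ⊤) (t : S) :
    SLReach Sig (119 * Nat.log 2 (Nat.card S) + 50) {t} := by
  have hR := slReach_costRel Sig
  obtain ⟨w, hw, hwR⟩ := band_reach π idem nrm Sig hS t
  obtain ⟨H, iH, hHs, φ, hφmul, hφsurj, hφinj⟩ := hsol (π t)
  set α := π t with hα
  have : Group.IsSolvable H := hHs
  choose ψ hψ1 hψ2 using hφsurj
  have hψφ : ∀ s, π s = α → ψ (φ s) = s := fun s hs => hφinj _ _ (hψ1 _) hs (hψ2 _)
  have hψmul : ∀ g h, ψ (g * h) = ψ g * ψ h := by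
    intro g h
    refine hφinj _ _ (hψ1 _) ?_ ?_
    · rw [map_mul, hψ1, hψ1, idem]
    · rw [hψ2, hφmul _ _ (hψ1 _) (hψ1 _), hψ2, hψ2]
  have : Finite H := Finite.of_injective ψ (fun a b h => by rw [← hψ2 a, h, hψ2])
  have hcardH : Nat.card H ≤ Nat.card S :=
    Nat.card_le_card_of_injective ψ (fun a b h => by rw [← hψ2 a, h, hψ2])
  have hcardB : Nat.card B ≤ Nat.card S := Nat.card_le_card_of_surjective π hsurj
  have hee : ∀ β, e β * e β = e β := by
    intro β
    have := (hid (e β)).1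
    rwa [hπe] at this
  have hidem : ∀ f : S, f * f = f → e (π f) = f := by
    intro f hf
    obtain ⟨f', -, h1, -⟩ := hinv f
    have h2 := (hid f).2
    rw [← h1, ← mul_assoc, hf, h1] at h2
    exact h2
  have hφe : φ (e α) = 1 := by
    have := hφmul (e α) (e α) (hπe α) (hπe α)
    rw [hee] at this
    exact left_eq_mul.1 this
  have hψ1e : ψ 1 = e α := by rw [← hφe, hψφ _ (hπe α)]
  have hfl : ∀ s, π s = α → e α * s = s := fun s hs => by rw [← hs]; exact (hid s).1
  have hfr : ∀ s, π s = α → s * e α = s := fun s hs => by rw [← hs]; exact (hid s).2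
  have heR : SLReach Sig (2 * Nat.log 2 (Nat.card B) + 3 + 2 * (Nat.log 2 (Nat.card H) + 1))
      {e α} := by
    have := hR.pow_aux (fun n => ψ (φ w ^ n)) (fun a b _ _ => by rw [pow_add, hψmul]) {w}
      (by simp [hψφ w hw]) _ hwR (Nat.log 2 (Nat.card H) + 1) (orderOf (φ w)) (orderOf_pos _)
      (lt_of_le_of_lt orderOf_le_card (Nat.lt_pow_succ_log_self (by norm_num) _))
    rw [pow_orderOf_eq_one, hψ1e] at this
    exact hR.mono _ _ _ _ le_rfl (by simp) this
  let T : Set H := {h | h = 1 ∨ (∃ s ∈ Sig, α * π s * α = α ∧ h = φ (e α * s * e α)) ∨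
    ∃ s ∈ Sig, ∃ s' ∈ Sig, α * π s * α = α ∧ α * π s' * α = α ∧ h = φ (e α * s * s' * e α)}
  have hfib : ∀ s, α * π s * α = α → π (e α * s * e α) = α := by
    intro s hs
    rw [map_mul, map_mul, hπe, hs]
  have hfib2 : ∀ s s', α * π s * α = α → α * π s' * α = α → π (e α * s * s' * e α) = α := by
    intro s s' hs hs'
    rw [map_mul, map_mul, map_mul, hπe, mul_assoc α, band_mul idem nrm hs hs']
  have hkey : ∀ y s c, α * π y * α = α → α * π s * α = α → α * π c * α = α →
      α * π y = α * π s →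
      φ (e α * y * c * e α) = φ (e α * y * e α) * (φ (e α * s * e α))⁻¹ *
        φ (e α * s * c * e α) := by
    intro y s c hy hs hc hys
    obtain ⟨v, hv1, hv2, hv3⟩ := hinv (e α * s * e α)
    rw [hfib s hs] at hv1 hv2 hv3
    have hev := hfl v hv1
    have hve := hfr v hv1
    have hφv : φ v = (φ (e α * s * e α))⁻¹ := by
      rw [eq_inv_iff_mul_eq_one, ← hφmul _ _ hv1 (hfib s hs), hv3, hφe]
    have hff : (v * (e α * s)) * (v * (e α * s)) = v * (e α * s) := by
      calc (v * (e α * s)) * (v * (e α * s))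
          = v * (e α * s) * ((e α * v) * (e α * s)) := by rw [hev]
        _ = v * (e α * s * e α) * v * (e α * s) := by simp only [mul_assoc]
        _ = v * (e α * s) := by rw [hv3, hev]
    have hf := hidem _ hff
    have hπf : π (v * (e α * s)) = α * π y := by
      rw [map_mul, map_mul, hπe, hv1, ← mul_assoc, idem, hys]
    rw [hπf] at hf
    have hy2 := (hid (e α * y)).2
    rw [map_mul, hπe, hf] at hy2
    have hprod : e α * y * c * e α = (e α * y * e α) * v * (e α * s * c * e α) := by
      calc e α * y * c * e α = e α * y * (v * (e α * s)) * c * e α := by rw [hy2]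
        _ = e α * y * ((e α * v) * (e α * s)) * c * e α := by rw [hev]
        _ = (e α * y * e α) * v * (e α * s * c * e α) := by simp only [mul_assoc]
    rw [hprod, hφmul _ _ _ (hfib2 s c hs hc), hφmul _ _ (hfib y hy) hv1, hφv]
    rw [map_mul, hfib y hy, hv1, idem]
  have hgen : ∀ x ∈ Subsemigroup.closure Sig,
      (α * π x * α = α → (φ (e α * x * e α) ∈ Subgroup.closure T ∧
        ∃ s ∈ Sig, α * π s * α = α ∧ α * π x = α * π s)) ∧
      ∀ y, α * π y * α = α → φ (e α * y * e α) ∈ Subgroup.closure T →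
        (∃ s ∈ Sig, α * π s * α = α ∧ α * π y = α * π s) → α * π x * α = α →
        (φ (e α * (y * x) * e α) ∈ Subgroup.closure T ∧
        ∃ s ∈ Sig, α * π s * α = α ∧ α * π (y * x) = α * π s) := by
    intro x hx
    induction hx using Subsemigroup.closure_induction with
    | mem x hx =>
      refine ⟨fun h => ⟨Subgroup.subset_closure (Or.inr (Or.inl ⟨x, hx, h, rfl⟩)),
        x, hx, h, rfl⟩, ?_⟩
      rintro y hy hyT ⟨s, hs, hsα, hys⟩ hxα
      refine ⟨?_, x, hx, hxα, ?_⟩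
      · rw [← mul_assoc, hkey y s x hy hsα hxα hys]
        refine mul_mem (mul_mem hyT (inv_mem (Subgroup.subset_closure
          (Or.inr (Or.inl ⟨s, hs, hsα, rfl⟩))))) (Subgroup.subset_closure
          (Or.inr (Or.inr ⟨s, hs, x, hx, hsα, hxα, rfl⟩)))
      · rw [map_mul, band_absorb idem nrm hy]
    | mul x x' _ _ hx hx' =>
      constructor
      · intro h
        rw [map_mul] at h
        have h1 := band_left idem nrm h
        have h2 := band_right idem nrm h
        obtain ⟨g1, g2⟩ := hx.1 h1
        exact hx'.2 x h1 g1 g2 h2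
      · intro y hy hyT hys h
        rw [map_mul] at h
        have h1 := band_left idem nrm h
        have h2 := band_right idem nrm h
        obtain ⟨g1, g2⟩ := hx.2 y hy hyT hys h1
        have := hx'.2 (y * x) (by rw [map_mul]; exact band_mul idem nrm hy h1) g1 g2 h2
        rwa [mul_assoc y x x'] at this
  have hT : Subgroup.closure T = ⊤ := by
    rw [eq_top_iff]
    intro h _
    have hα' : α * π (ψ h) * α = α := by rw [hψ1, idem, idem]
    have := ((hgen (ψ h) (by rw [hS]; trivial)).1 hα').1
    rwa [hfl _ (hψ1 h), hfr _ (hψ1 h), hψ2] at this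
  set k₀ := 2 * Nat.log 2 (Nat.card B) + 3 + 2 * (Nat.log 2 (Nat.card H) + 1) with hk₀
  have hcost : CostRel T (fun k X => SLReach Sig (k₀ + 5 * k) (insert (e α) (ψ '' X))) := by
    refine ⟨?_, ?_, ?_, ?_⟩
    · simpa using heR
    · rintro k X h (rfl | ⟨s, hs, hsα, rfl⟩ | ⟨s, hs, s', hs', hsα, hsα', rfl⟩) hX
      · refine hR.mono _ _ _ _ (by omega) ?_ hX
        rw [Set.image_insert_eq, hψ1e]
        simp
      · have s1 := hR.gen _ _ _ hs hX
        have s2 := hR.mul _ _ (e α) s (by simp) (by simp) s1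
        have s3 := hR.mul _ _ (e α * s) (e α) (by simp) (by simp) s2
        refine hR.mono _ _ _ _ (by omega) ?_ s3
        rw [Set.image_insert_eq, hψφ _ (hfib s hsα)]
        intro z hz
        simp only [Set.mem_insert_iff] at hz ⊢
        tauto
      · have s1 := hR.gen _ _ _ hs hX
        have s2 := hR.gen _ _ _ hs' s1
        have s3 := hR.mul _ _ (e α) s (by simp) (by simp) s2
        have s4 := hR.mul _ _ (e α * s) s' (by simp) (by simp) s3
        have s5 := hR.mul _ _ (e α * s * s') (e α) (by simp) (by simp) s4
        refine hR.mono _ _ _ _ (by omega) ?_ s5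
        rw [Set.image_insert_eq, hψφ _ (hfib2 s s' hsα hsα')]
        intro z hz
        simp only [Set.mem_insert_iff] at hz ⊢
        tauto
    · intro k X x y hx hy hX
      have s1 := hR.mul _ _ (ψ x) (ψ y) (Set.mem_insert_of_mem _ (Set.mem_image_of_mem ψ hx))
        (Set.mem_insert_of_mem _ (Set.mem_image_of_mem ψ hy)) hX
      refine hR.mono _ _ _ _ (by omega) ?_ s1
      rw [Set.image_insert_eq, hψmul, Set.insert_comm]
    · intro k k' X X' hk hXX hX
      exact hR.mono _ _ _ _ (by omega) (Set.insert_subset_insert (Set.image_mono hXX)) hX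
  have hfinal := hcost.solvable_group (Or.inl rfl) hT (φ t)
  refine hR.mono _ _ _ _ ?_ ?_ hfinal
  · have l1 : Nat.log 2 (Nat.card H) ≤ Nat.log 2 (Nat.card S) := Nat.log_mono_right hcardH
    have l2 : Nat.log 2 (Nat.card B) ≤ Nat.log 2 (Nat.card S) := Nat.log_mono_right hcardB
    omega
  · rw [Set.image_singleton, hψφ t rfl]
    simp

/-- finite normal bands of solvable groups admit straight-line sequences
of length `O(log |S|)`. -/
theorem normal_band_of_solvable_groups_log_cost :
    ∃ C : ℝ, 0 < C ∧
      ∀ (S B : Type) [Semigroup S] [Fintype S] [Semigroup B] [Fintype B]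
        (π : S →ₙ* B) (e : B → S),
        Function.Surjective π →
        (∀ b : B, b * b = b) →
        (∀ a x y b : B, a * x * y * b = a * y * x * b) →
        (∀ α : B, π (e α) = α) →
        (∀ s : S, e (π s) * s = s ∧ s * e (π s) = s) →
        (∀ s : S, ∃ s' : S, π s' = π s ∧ s * s' = e (π s) ∧ s' * s = e (π s)) →
        (∀ α : B, FiberSolvable (⇑π) α) →
        ∀ Sig : Set S, Subsemigroup.closure Sig = ⊤ →
          ∀ t : S, ∃ L : List S, IsSLSeq Sig L ∧ t ∈ L ∧
            (L.length : ℝ) ≤ C * (Real.logb 2 (Fintype.card S) + 1) := by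
  refine ⟨119, by norm_num, ?_⟩
  intro S B _ _ _ _ π e hsurj idem nrm hπe hid hinv hsol Sig hS t
  obtain ⟨L, hL, ht, hlen⟩ := normal_band_nat_bound S B π e hsurj idem nrm hπe hid hinv hsol
    Sig hS t
  refine ⟨L, hL, ht t rfl, ?_⟩
  have h1 : (Nat.log 2 (Fintype.card S) : ℝ) ≤ Real.logb 2 (Fintype.card S) := by
    exact_mod_cast Real.natLog_le_logb (Fintype.card S) 2
  rw [Nat.card_eq_fintype_card] at hlen
  have h2 : (L.length : ℝ) ≤ 119 * (Nat.log 2 (Fintype.card S) : ℝ) + 50 := by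
    exact_mod_cast hlen
  linarith
end
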